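/- arXiv:2405.15009 — 8 statements merged into one kernel-verified Lean document; each statement's English description precedes it below -/
import Mathlib

section
/- Let φ be a positive linear map on a unital C*-algebra A. If there exists a positive element w ∈ A with φ(w) = s(w - 1) for some s > 0, then there is a strictly positive (i.e. positive and invertible) element v ∈ A such that ‖α_v⁻¹ ∘ φ ∘ α_v‖ < s, where α_v(x) = v*xv. -/
open Filter Topology

/-- Cauchy–Schwarz for positive elements of a C*-algebra weighted by unimodular scalars. -/
theorem norm_sum_smul_le_norm_sum_of_nonneg {B ι : Type*} [CStarAlgebra B] [PartialOrder B]
    [StarOrderedRing B] [Fintype ι] (p : ι → B) (hp : ∀ i, 0 ≤ p i) (c : ι → ℂ)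
    (hc : ∀ i, ‖c i‖ = 1) : ‖∑ i, c i • p i‖ ≤ ‖∑ i, p i‖ := by
  let x : WithCStarModule B (ι → B) := (WithCStarModule.equiv B _).symm fun i => CFC.sqrt (p i)
  let y : WithCStarModule B (ι → B) :=
    (WithCStarModule.equiv B _).symm fun i => c i • CFC.sqrt (p i)
  have hsa (i : ι) : star (CFC.sqrt (p i)) = CFC.sqrt (p i) :=
    (CFC.sqrt_nonneg (p i)).isSelfAdjoint
  have hsq (i : ι) : CFC.sqrt (p i) * CFC.sqrt (p i) = p i := CFC.sqrt_mul_sqrt_self _ (hp i)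
  have hcc (i : ι) : star (c i) * c i = 1 := by
    have h := RCLike.conj_mul (c i)
    rw [hc i] at h
    simpa using h
  have hxx : ‖x‖ ^ 2 = ‖∑ i, p i‖ := by
    simp [WithCStarModule.pi_norm_sq, WithCStarModule.inner_def, x, hsa, hsq]
  have hyy : ‖y‖ ^ 2 = ‖∑ i, p i‖ := by
    rw [WithCStarModule.pi_norm_sq]
    simp only [WithCStarModule.inner_def, y, WithCStarModule.equiv_symm_pi_apply, star_smul, hsa,
      smul_mul_smul_comm, hsq, mul_comm (c _), hcc, one_smul]
  have hxy : inner B x y = ∑ i, c i • p i := by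
    simp [WithCStarModule.pi_inner, WithCStarModule.inner_def, x, y, hsa, hsq]
  have h := CStarModule.norm_inner_le (A := B) (WithCStarModule B (ι → B)) (x := x) (y := y)
  rw [hxy] at h
  nlinarith [sq_nonneg (‖x‖ - ‖y‖)]

theorem IsPrimitiveRoot.sum_pow_pow {K : Type*} [Field K] {ζ : K} {n : ℕ}
    (h : IsPrimitiveRoot ζ n) (m : ℕ) :
    ∑ j : Fin n, (ζ ^ (j : ℕ)) ^ m = if n ∣ m then (n : K) else 0 := by
  simp_rw [← pow_mul, mul_comm _ m, pow_mul]
  rw [Fin.sum_univ_eq_sum_range (fun j => (ζ ^ m) ^ j)]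
  split_ifs with hm
  · simp [(h.pow_eq_one_iff_dvd m).2 hm]
  · have hne : ζ ^ m - 1 ≠ 0 := sub_ne_zero.2 (mt (h.pow_eq_one_iff_dvd m).1 hm)
    have hg := mul_geom_sum (ζ ^ m) n
    rw [← pow_mul, mul_comm m n, pow_mul, h.pow_eq_one, one_pow, sub_self] at hg
    exact (mul_eq_zero.1 hg).resolve_left hne

/-- Averaging a polynomial over the roots of unity extracts one coefficient. -/
theorem IsPrimitiveRoot.sum_pow_smul_geom_sum {K B : Type*} [Field K] [Ring B] [Algebra K B]
    {ζ : K} {n : ℕ} (h : IsPrimitiveRoot ζ n) (a : B) {m r : ℕ} (hr : r < n) (hmr : n ∣ m + r) :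
    ∑ j : Fin n, (ζ ^ (j : ℕ)) ^ m • ∑ k ∈ Finset.range n, (ζ ^ (j : ℕ) • a) ^ k =
      (n : K) • a ^ r := by
  simp_rw [smul_pow, Finset.smul_sum, smul_smul, ← pow_add]
  rw [Finset.sum_comm]
  simp_rw [← Finset.sum_smul, h.sum_pow_pow]
  rw [Finset.sum_eq_single_of_mem r (Finset.mem_range.2 hr)]
  · rw [if_pos hmr]
  · intro k hk hkr
    rw [if_neg, zero_smul]
    intro hmk
    refine hkr (Nat.ModEq.eq_of_lt_of_lt ?_ (Finset.mem_range.1 hk) hr)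
    refine Nat.ModEq.add_left_cancel' m ?_
    exact ((Nat.modEq_zero_iff_dvd.2 hmk).trans (Nat.modEq_zero_iff_dvd.2 hmr).symm)

/-- If `b` is a right inverse of `1 - c` for a contraction `c`, then `2 Re b ≥ 1`. -/
theorem add_star_sub_one_nonneg_of_norm_le_one {A : Type*} [CStarAlgebra A] [PartialOrder A]
    [StarOrderedRing A] {c b : A} (hc : ‖c‖ ≤ 1) (hb : (1 - c) * b = 1) :
    0 ≤ b + star b - 1 := by
  have hcb : c * b = b - 1 := by
    rw [sub_mul, one_mul] at hb
    rw [← hb]; abel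
  have h1 : star c * c ≤ 1 := by
    rw [← CStarAlgebra.norm_le_one_iff_of_nonneg (star c * c) (star_mul_self_nonneg c),
      CStarRing.norm_star_mul_self]
    exact mul_le_one₀ hc (norm_nonneg _) hc
  have h2 := star_left_conjugate_nonneg (sub_nonneg.2 h1) b
  have h3 : star b * (1 - star c * c) * b = star b * b - star (c * b) * (c * b) := by
    rw [star_mul]; noncomm_ring
  rw [h3, hcb, star_sub, star_one] at h2
  convert h2 using 1
  noncomm_ring

section RussoDye

variable {A B : Type*} [CStarAlgebra A] [PartialOrder A] [StarOrderedRing A]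
  [CStarAlgebra B] [PartialOrder B] [StarOrderedRing B]

/-- Discretised Poisson kernel estimate for positive maps. -/
theorem norm_map_add_star_le_of_pow_inverse (φ : A →L[ℂ] B) (hφ : ∀ a, 0 ≤ a → 0 ≤ φ a)
    {a r : A} (ha : ‖a‖ ≤ 1) {n : ℕ} (hn : 2 ≤ n) (hr : (1 - a ^ n) * r = 1) :
    ‖φ (a * r + star (a ^ (n - 1) * r))‖ ≤ ‖φ (r + star r - 1)‖ := by
  have hn0 : n ≠ 0 := by omega
  obtain ⟨ζ, hζ⟩ : ∃ ζ : ℂ, IsPrimitiveRoot ζ n := ⟨_, Complex.isPrimitiveRoot_exp n hn0⟩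
  have hζn : ‖ζ‖ = 1 := hζ.norm'_eq_one hn0
  let z (j : Fin n) : ℂ := ζ ^ (j : ℕ)
  have hz (j) : ‖z j‖ = 1 := by simp [z, hζn]
  have hzn (j) : z j ^ n = 1 := by
    simp only [z]; rw [← pow_mul, mul_comm, pow_mul, hζ.pow_eq_one, one_pow]
  have hzstar (j) : star (z j) = z j ^ (n - 1) := by
    have hzz : star (z j) * z j = 1 := by
      have h := RCLike.conj_mul (z j)
      rw [hz j] at h
      simpa using h
    have hz' : z j ^ (n - 1) * z j = 1 := by rw [← pow_succ, Nat.sub_add_cancel (by omega), hzn]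
    exact mul_right_cancel₀ (right_ne_zero_of_mul_eq_one hzz) (hzz.trans hz'.symm)
  let b (j : Fin n) : A := (∑ k ∈ Finset.range n, (z j • a) ^ k) * r
  have hb (j) : (1 - z j • a) * b j = 1 := by
    simp only [b]
    rw [← mul_assoc, mul_neg_geom_sum, smul_pow, hzn, one_smul, hr]
  have hP (j) : 0 ≤ b j + star (b j) - 1 :=
    add_star_sub_one_nonneg_of_norm_le_one (by rw [norm_smul, hz, one_mul]; exact ha) (hb j)
  have hsum {m k : ℕ} (hk : k < n) (hmk : n ∣ m + k) :
      ∑ j, z j ^ m • b j = (n : ℂ) • (a ^ k * r) := by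
    simp only [b, z, ← smul_mul_assoc]
    rw [← Finset.sum_mul, hζ.sum_pow_smul_geom_sum a hk hmk]
  have key := norm_sum_smul_le_norm_sum_of_nonneg (fun j => φ (b j + star (b j) - 1))
    (fun j => hφ _ (hP j)) (fun j => z j ^ (n - 1)) (fun j => by rw [norm_pow, hz, one_pow])
  simp_rw [← map_smul] at key
  rw [← map_sum, ← map_sum] at key
  have h1 : ∑ j, (b j + star (b j) - 1) = (n : ℂ) • (r + star r - 1) := by
    have h0 : ∑ j, b j = (n : ℂ) • r := by
      simpa using hsum (m := 0) (k := 0) (by omega) (by simp)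
    rw [Finset.sum_sub_distrib, Finset.sum_add_distrib, ← star_sum, h0, star_smul, star_natCast]
    simp [smul_sub, smul_add, Nat.cast_smul_eq_nsmul]
  have h2 : ∑ j, z j ^ (n - 1) • (b j + star (b j) - 1) =
      (n : ℂ) • (a * r + star (a ^ (n - 1) * r)) := by
    have h3 : ∑ j, z j ^ (n - 1) • b j = (n : ℂ) • (a * r) := by
      simpa using hsum (m := n - 1) (k := 1) (by omega)
        (by rw [Nat.sub_add_cancel (by omega)])
    have h4 : ∑ j, z j ^ (n - 1) • star (b j) = (n : ℂ) • star (a ^ (n - 1) * r) := by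
      have h5 := hsum (m := 1) (k := n - 1) (by omega)
        (by rw [Nat.add_sub_cancel' (by omega)])
      have h6 := congrArg star h5
      simp only [star_sum, star_smul, pow_one, hzstar, star_natCast] at h6
      exact h6
    have h7 : ∑ j, z j ^ (n - 1) = 0 := by
      rw [hζ.sum_pow_pow, if_neg]
      exact Nat.not_dvd_of_pos_of_lt (by omega) (by omega)
    simp only [smul_sub, smul_add, Finset.sum_sub_distrib, Finset.sum_add_distrib]
    rw [h3, h4, ← Finset.sum_smul, h7, zero_smul, sub_zero]
  rw [h1, h2, map_smul, map_smul, norm_smul, norm_smul] at key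
  exact le_of_mul_le_mul_left key (by simpa using Nat.pos_of_ne_zero hn0)

theorem norm_map_le_norm_map_one_of_norm_lt_one (φ : A →L[ℂ] B) (hφ : ∀ a, 0 ≤ a → 0 ≤ φ a)
    {a : A} (ha : ‖a‖ < 1) : ‖φ a‖ ≤ ‖φ 1‖ := by
  have hpow : Tendsto (fun n : ℕ => a ^ n) atTop (𝓝 0) :=
    tendsto_pow_atTop_nhds_zero_of_norm_lt_one ha
  have hpow' : Tendsto (fun n : ℕ => a ^ (n - 1)) atTop (𝓝 0) :=
    hpow.comp (tendsto_sub_atTop_nat 1)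
  let r (n : ℕ) : A := Ring.inverse (1 - a ^ n)
  have hr : Tendsto r atTop (𝓝 1) := by
    have h1 : Tendsto (fun n : ℕ => 1 - a ^ n) atTop (𝓝 ((1 : Aˣ) : A)) := by
      simpa using hpow.const_sub 1
    simpa [r, Function.comp_def] using
      (NormedRing.inverse_continuousAt (1 : Aˣ)).tendsto.comp h1
  have hl : Tendsto (fun n => ‖φ (a * r n + star (a ^ (n - 1) * r n))‖) atTop (𝓝 ‖φ a‖) := by
    have h := (hr.const_mul a).add (hpow'.mul hr).star
    simp only [mul_one, star_zero, add_zero] at h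
    exact ((φ.continuous.tendsto a).comp h).norm
  have hrhs : Tendsto (fun n => ‖φ (r n + star (r n) - 1)‖) atTop (𝓝 ‖φ 1‖) := by
    have h := (hr.add hr.star).sub_const 1
    simp only [star_one, add_sub_cancel_right] at h
    exact ((φ.continuous.tendsto 1).comp h).norm
  refine le_of_tendsto_of_tendsto hl hrhs ?_
  filter_upwards [eventually_ge_atTop 2] with n hn
  refine norm_map_add_star_le_of_pow_inverse φ hφ ha.le hn (Ring.mul_inverse_cancel _ ?_)
  refine isUnit_one_sub_of_norm_lt_one ?_
  exact (norm_pow_le' a (by omega)).trans_lt (pow_lt_one₀ (norm_nonneg a) ha (by omega))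

/-- **Russo–Dye**: a positive map between unital C*-algebras attains its norm at `1`. -/
theorem opNorm_le_norm_map_one_of_positive (φ : A →L[ℂ] B) (hφ : ∀ a, 0 ≤ a → 0 ≤ φ a) :
    ‖φ‖ ≤ ‖φ 1‖ := by
  rw [← φ.sSup_unit_ball_eq_norm]
  refine csSup_le ((Metric.nonempty_ball.2 one_pos).image _) ?_
  rintro _ ⟨a, ha, rfl⟩
  exact norm_map_le_norm_map_one_of_norm_lt_one φ hφ (mem_ball_zero_iff.1 ha)

end RussoDye

/-- If `φ` is positive on a unital C*-algebra and `φ(w) = s(w-1)` for some positive `w`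
and `s > 0`, then there is a strictly positive `v` with `‖α_v⁻¹ ∘ φ ∘ α_v‖ < s`. -/
theorem stmt1 {A : Type*} [CStarAlgebra A] [PartialOrder A] [StarOrderedRing A]
    (φ : A →L[ℂ] A) (hφ : ∀ a : A, 0 ≤ a → 0 ≤ φ a)
    (s : ℝ) (hs : 0 < s)
    (w : A) (hw : 0 ≤ w) (hw2 : φ w = (s : ℂ) • (w - 1)) :
    ∃ v : Aˣ, 0 ≤ (v : A) ∧
      ‖(ContinuousLinearMap.mulLeftRight ℂ A (star ((↑v⁻¹ : A))) (↑v⁻¹ : A)).comp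
        (φ.comp (ContinuousLinearMap.mulLeftRight ℂ A (star (v : A)) (v : A)))‖ < s := by
  have hw1 : 1 ≤ w := by
    have h := smul_nonneg (inv_nonneg.2 hs.le) (hφ w hw)
    rw [hw2, Complex.coe_smul, smul_smul, inv_mul_cancel₀ hs.ne', one_smul] at h
    exact sub_nonneg.1 h
  have hwu : IsUnit w := CStarAlgebra.isUnit_of_le 1 hw1
  have hvv : CFC.sqrt w * CFC.sqrt w = w := CFC.sqrt_mul_sqrt_self w hw
  have hvu : IsUnit (CFC.sqrt w) := by rwa [CFC.isUnit_sqrt_iff w hw]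
  obtain ⟨v, hv⟩ := hvu
  have hv0 : 0 ≤ (v : A) := hv ▸ CFC.sqrt_nonneg w
  have hvsa : star (v : A) = v := hv0.isSelfAdjoint
  rw [← hv] at hvv
  refine ⟨v, hv0, (opNorm_le_norm_map_one_of_positive _ fun a ha => ?_).trans_lt ?_⟩
  · exact star_left_conjugate_nonneg (hφ _ (star_left_conjugate_nonneg ha (v : A))) (↑v⁻¹ : A)
  rcases subsingleton_or_nontrivial A with hA | hA
  · exact (norm_of_subsingleton _).trans_lt hs
  have hnw : 1 ≤ ‖w‖ := by
    simpa using CStarAlgebra.norm_le_norm_of_nonneg_of_le zero_le_one hw1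
  have hle : w - 1 ≤ (1 - ‖w‖⁻¹) • w := by
    have h1 := (IsSelfAdjoint.of_nonneg hw).le_algebraMap_norm_self
    rw [Algebra.algebraMap_eq_smul_one] at h1
    have h2 := smul_le_smul_of_nonneg_left h1 (inv_nonneg.2 (norm_nonneg w))
    rw [smul_smul, inv_mul_cancel₀ (by positivity), one_smul] at h2
    rw [sub_smul, one_smul]
    exact sub_le_sub_left h2 w
  have hvinv : star (↑v⁻¹ : A) * w * ↑v⁻¹ = 1 := by
    rw [← hvv, ← mul_assoc, mul_assoc, Units.mul_inv, mul_one]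
    have h := congrArg star v.mul_inv
    rwa [star_mul, hvsa, star_one] at h
  have hconj := star_left_conjugate_le_conjugate hle (↑v⁻¹ : A)
  rw [mul_smul_comm, smul_mul_assoc, hvinv] at hconj
  have hnorm := CStarAlgebra.norm_le_norm_of_nonneg_of_le
    (star_left_conjugate_nonneg (sub_nonneg.2 hw1) (↑v⁻¹ : A)) hconj
  have ht : 0 ≤ 1 - ‖w‖⁻¹ := sub_nonneg.2 (inv_le_one_of_one_le₀ hnw)
  rw [norm_smul, norm_one, mul_one, Real.norm_of_nonneg ht] at hnorm
  simp only [ContinuousLinearMap.comp_apply, ContinuousLinearMap.mulLeftRight_apply, mul_one]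
  rw [hvsa, hvv, hw2, mul_smul_comm, smul_mul_assoc, norm_smul, Complex.norm_of_nonneg hs.le]
  have hpos : 0 < ‖w‖⁻¹ := by positivity
  nlinarith
end

section
/- Let φ be a positive linear map on a unital C*-algebra A. Then the spectral radius of φ equals the infimum of ‖α_v⁻¹ ∘ φ ∘ α_v‖ over all strictly positive (positive invertible) elements v ∈ A, where α_v(x) = v*xv. -/
open Finset in
/-- Unimodular coefficients do not increase the norm of a finite sum of positive elements. -/
theorem CStarAlgebra.norm_sum_smul_le_of_nonneg {A ι : Type*} [CStarAlgebra A] [PartialOrder A]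
    [StarOrderedRing A] [Fintype ι] {q : ι → A} (hq : ∀ i, 0 ≤ q i) {c : ι → ℂ}
    (hc : ∀ i, ‖c i‖ = 1) : ‖∑ i, c i • q i‖ ≤ ‖∑ i, q i‖ := by
  have hs (i : ι) : CFC.sqrt (q i) * star (CFC.sqrt (q i)) = q i := by
    rw [(CFC.sqrt_nonneg (q i)).isSelfAdjoint.star_eq, CFC.sqrt_mul_sqrt_self _ (hq i)]
  let x : WithCStarModule A (ι → A) := (WithCStarModule.equiv A (ι → A)).symm fun i ↦ CFC.sqrt (q i)
  let y : WithCStarModule A (ι → A) :=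
    (WithCStarModule.equiv A (ι → A)).symm fun i ↦ c i • CFC.sqrt (q i)
  have hxy : inner A x y = ∑ i, c i • q i := by
    simp [WithCStarModule.pi_inner, x, y, WithCStarModule.inner_def, hs]
  have hx : inner A x x = ∑ i, q i := by
    simp [WithCStarModule.pi_inner, x, WithCStarModule.inner_def, hs]
  have hy : inner A y y = ∑ i, q i := by
    have hcc (i : ι) : starRingEnd ℂ (c i) * c i = 1 := by
      simp [← Complex.normSq_eq_conj_mul_self, Complex.normSq_eq_norm_sq, hc]
    simp only [WithCStarModule.pi_inner, y, WithCStarModule.inner_def]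
    refine sum_congr rfl fun i _ ↦ ?_
    simp [smul_smul, hs, hcc]
  have hnx := CStarModule.norm_eq_sqrt_norm_inner_self (A := A) x
  have hny := CStarModule.norm_eq_sqrt_norm_inner_self (A := A) y
  calc ‖∑ i, c i • q i‖ = ‖inner A x y‖ := by rw [hxy]
    _ ≤ ‖x‖ * ‖y‖ := CStarModule.norm_inner_le _
    _ = ‖∑ i, q i‖ := by
      rw [hnx, hny, hx, hy, Real.mul_self_sqrt (norm_nonneg _)]

open Finset in
theorem IsPrimitiveRoot.sum_pow_mul_star_pow {N : ℕ} {ω : ℂ} (hω : IsPrimitiveRoot ω N)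
    (hN : N ≠ 0) (a b : ℕ) :
    ∑ k ∈ range N, (ω ^ k) ^ a * star (ω ^ k) ^ b = if a ≡ b [MOD N] then (N : ℂ) else 0 := by
  have hω0 : ω ≠ 0 := hω.ne_zero hN
  have hstar : star ω = ω⁻¹ := by
    rw [Complex.inv_def, Complex.normSq_eq_norm_sq, hω.norm'_eq_one hN]
    simp
  have hterm (k : ℕ) : (ω ^ k) ^ a * star (ω ^ k) ^ b = (ω ^ a * (ω ^ b)⁻¹) ^ k := by
    rw [star_pow, hstar, mul_pow, inv_pow, inv_pow, inv_pow, pow_right_comm, pow_right_comm ω b]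
  have hiff : ω ^ a * (ω ^ b)⁻¹ = 1 ↔ a ≡ b [MOD N] := by
    rw [mul_inv_eq_one₀ (pow_ne_zero _ hω0)]
    have h := pow_eq_pow_iff_modEq (x := hω.isUnit hN |>.unit) (m := b) (n := a)
    rw [← Units.val_inj, ← orderOf_units] at h
    rw [hω.eq_orderOf]
    simpa using h
  simp_rw [hterm]
  split_ifs with h
  · simp [hiff.2 h]
  · rw [geom_sum_eq (mt hiff.1 h), mul_pow, inv_pow, ← pow_mul, ← pow_mul, mul_comm a,
      mul_comm b, pow_mul, pow_mul, hω.pow_eq_one]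
    simp

open Finset in
theorem IsPrimitiveRoot.sum_smul_star_mul_mul {A : Type*} [CStarAlgebra A] {N : ℕ} {ω : ℂ}
    (hω : IsPrimitiveRoot ω N) (hN : N ≠ 0) (x d : A) (m : ℕ) :
    ∑ k ∈ range N, (ω ^ k) ^ m • (star (∑ j ∈ range N, star (ω ^ k) ^ j • x ^ j) * d *
        ∑ j ∈ range N, star (ω ^ k) ^ j • x ^ j) =
      (N : ℂ) • ∑ i ∈ range N, ∑ j ∈ range N,
        if m + i ≡ j [MOD N] then star x ^ i * d * x ^ j else 0 := by
  have key (k : ℕ) : (ω ^ k) ^ m • (star (∑ j ∈ range N, star (ω ^ k) ^ j • x ^ j) * d *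
        ∑ j ∈ range N, star (ω ^ k) ^ j • x ^ j) =
      ∑ i ∈ range N, ∑ j ∈ range N,
        ((ω ^ k) ^ (m + i) * star (ω ^ k) ^ j) • (star x ^ i * d * x ^ j) := by
    rw [star_sum, sum_mul, sum_mul_sum, smul_sum]
    refine sum_congr rfl fun i _ ↦ ?_
    rw [smul_sum]
    refine sum_congr rfl fun j _ ↦ ?_
    simp only [star_smul, star_pow, star_star, smul_mul_assoc, mul_smul_comm, smul_smul, pow_add]
    congr 1
    ring
  simp_rw [key]
  rw [sum_comm, smul_sum]
  refine sum_congr rfl fun i _ ↦ ?_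
  rw [sum_comm, smul_sum]
  refine sum_congr rfl fun j _ ↦ ?_
  rw [← sum_smul, hω.sum_pow_mul_star_pow hN]
  split_ifs <;> simp

open Finset in
/-- With `ω` a primitive root of unity of order `M + 1` and `G k = ∑ j ≤ M, ω⁻ᵏʲ xʲ`, both
arguments of `φ` are averages of the positive elements `G k⋆ (1 - x⋆x) G k`, the one on the left
with weights `ωᵏ`. -/
theorem ContinuousLinearMap.norm_apply_approx_le {A B : Type*} [CStarAlgebra A] [PartialOrder A]
    [StarOrderedRing A] [CStarAlgebra B] [PartialOrder B] [StarOrderedRing B]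
    (φ : A →L[ℂ] B) (hφ : ∀ a : A, 0 ≤ a → 0 ≤ φ a) {x : A} (hx : ‖x‖ ≤ 1) (M : ℕ) :
    ‖φ ((1 - star x ^ M * x ^ M) * x + star x ^ M * (1 - star x * x))‖ ≤
      ‖φ (1 - star x ^ (M + 1) * x ^ (M + 1))‖ := by
  obtain ⟨ω, hω⟩ : ∃ ω : ℂ, IsPrimitiveRoot ω (M + 1) :=
    ⟨_, Complex.isPrimitiveRoot_exp _ M.succ_ne_zero⟩
  have hd : 0 ≤ 1 - star x * x := by
    rw [sub_nonneg]
    refine CStarAlgebra.star_mul_le_algebraMap_norm_sq.trans ?_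
    rw [← map_one (algebraMap ℝ A)]
    exact algebraMap_mono A (pow_le_one₀ (norm_nonneg _) hx)
  set d := 1 - star x * x with hd_def
  let G (k : ℕ) : A := ∑ j ∈ range (M + 1), star (ω ^ k) ^ j • x ^ j
  have htel (n : ℕ) : ∑ i ∈ range n, star x ^ i * d * x ^ i = 1 - star x ^ n * x ^ n := by
    induction n with
    | zero => simp
    | succ n ih =>
      rw [sum_range_succ, ih, hd_def, pow_succ (star x), pow_succ' x]
      noncomm_ring
  have h0 : ∑ k ∈ range (M + 1), star (G k) * d * G k =
      ((M + 1 : ℕ) : ℂ) • (1 - star x ^ (M + 1) * x ^ (M + 1)) := by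
    have := hω.sum_smul_star_mul_mul M.succ_ne_zero x d 0
    simp only [pow_zero, one_smul, zero_add] at this
    rw [this, ← htel]
    congr 1
    refine sum_congr rfl fun i hi ↦ ?_
    rw [sum_eq_single_of_mem i hi, if_pos (Nat.ModEq.refl i)]
    exact fun j hj hji ↦ if_neg fun h ↦
      hji (h.eq_of_lt_of_lt (mem_range.1 hi) (mem_range.1 hj)).symm
  have h1 : ∑ k ∈ range (M + 1), ω ^ k • (star (G k) * d * G k) =
      ((M + 1 : ℕ) : ℂ) • ((1 - star x ^ M * x ^ M) * x + star x ^ M * d) := by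
    have := hω.sum_smul_star_mul_mul M.succ_ne_zero x d 1
    simp only [pow_one] at this
    rw [this, ← htel, sum_range_succ, sum_mul]
    congr 2
    · refine sum_congr rfl fun i hi ↦ ?_
      have hi' : 1 + i < M + 1 := by have := mem_range.1 hi; omega
      rw [sum_eq_single_of_mem (1 + i) (mem_range.2 hi'), if_pos (Nat.ModEq.refl _),
        add_comm 1 i, pow_succ, mul_assoc _ (x ^ i)]
      exact fun j hj hji ↦ if_neg fun h ↦
        hji (h.eq_of_lt_of_lt hi' (mem_range.1 hj)).symm
    · rw [sum_eq_single_of_mem 0 (by simp), if_pos, pow_zero, mul_one]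
      · simp [Nat.ModEq, add_comm 1 M]
      · refine fun j hj hj0 ↦ if_neg fun h ↦ hj0 ?_
        simpa [Nat.ModEq, add_comm 1 M, Nat.mod_eq_of_lt (mem_range.1 hj), eq_comm] using h
  have hle := CStarAlgebra.norm_sum_smul_le_of_nonneg (ι := Fin (M + 1))
    (q := fun k ↦ φ (star (G k) * d * G k)) (c := fun k ↦ ω ^ (k : ℕ))
    (fun k ↦ hφ _ (star_left_conjugate_nonneg hd _))
    (fun k ↦ by rw [norm_pow, hω.norm'_eq_one M.succ_ne_zero, one_pow])
  rw [Fin.sum_univ_eq_sum_range (fun k ↦ ω ^ k • φ (star (G k) * d * G k)),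
    Fin.sum_univ_eq_sum_range (fun k ↦ φ (star (G k) * d * G k))] at hle
  simp_rw [← map_smul, ← map_sum] at hle
  rw [h0, h1, map_smul, map_smul, norm_smul, norm_smul] at hle
  refine le_of_mul_le_mul_left hle (norm_pos_iff.2 ?_)
  exact_mod_cast M.succ_ne_zero

open Filter Topology in
/-- **Russo-Dye**: a positive map between unital C⋆-algebras attains its norm at `1`. -/
theorem ContinuousLinearMap.opNorm_le_norm_apply_one {A B : Type*} [CStarAlgebra A]
    [PartialOrder A] [StarOrderedRing A] [CStarAlgebra B] [PartialOrder B] [StarOrderedRing B]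
    (φ : A →L[ℂ] B) (hφ : ∀ a : A, 0 ≤ a → 0 ≤ φ a) : ‖φ‖ ≤ ‖φ 1‖ := by
  have hball : Metric.ball (0 : A) 1 ⊆ {x | ‖φ x‖ ≤ ‖φ 1‖} := by
    intro x hx
    rw [mem_ball_zero_iff] at hx
    have hp : Tendsto (fun n : ℕ ↦ x ^ n) atTop (𝓝 0) :=
      tendsto_pow_atTop_nhds_zero_of_norm_lt_one hx
    have hs : Tendsto (fun n : ℕ ↦ star x ^ n) atTop (𝓝 0) :=
      tendsto_pow_atTop_nhds_zero_of_norm_lt_one (by rwa [norm_star])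
    have hl : Tendsto (fun M : ℕ ↦ (1 - star x ^ M * x ^ M) * x + star x ^ M * (1 - star x * x))
        atTop (𝓝 x) := by
      simpa using (((hs.mul hp).const_sub 1).mul_const x).add (hs.mul_const (1 - star x * x))
    have hr : Tendsto (fun M : ℕ ↦ 1 - star x ^ (M + 1) * x ^ (M + 1)) atTop (𝓝 1) := by
      simpa [Function.comp_def] using
        ((hs.mul hp).const_sub 1).comp (tendsto_add_atTop_nat 1)
    exact le_of_tendsto_of_tendsto' ((φ.continuous.tendsto _).comp hl).norm
      ((φ.continuous.tendsto _).comp hr).norm (φ.norm_apply_approx_le hφ hx.le)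
  refine φ.opNorm_le_of_unit_norm (norm_nonneg _) fun x hx ↦ ?_
  have hclosed : IsClosed {x | ‖φ x‖ ≤ ‖φ 1‖} := isClosed_le (by fun_prop) continuous_const
  have := closure_minimal hball hclosed
  rw [closure_ball _ one_ne_zero] at this
  exact this (by simp [hx])

open Filter in
open scoped NNReal ENNReal in
theorem spectrum.summable_smul_pow_of_spectralRadius_lt {R : Type*} [NormedRing R]
    [NormedAlgebra ℂ R] [CompleteSpace R] (a : R) {r : ℝ≥0} (hr : spectralRadius ℂ a < r) :
    Summable fun n : ℕ ↦ ((r : ℝ) : ℂ)⁻¹ ^ n • a ^ n := by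
  obtain ⟨s, hs, hsr⟩ := ENNReal.lt_iff_exists_nnreal_btwn.1 hr
  have hsr : s < r := by exact_mod_cast hsr
  have hr0 : 0 < r := bot_le.trans_lt hsr
  have hev : ∀ᶠ n : ℕ in atTop, ‖((r : ℝ) : ℂ)⁻¹ ^ n • a ^ n‖ ≤ ((s / r : ℝ≥0) : ℝ) ^ n := by
    filter_upwards [(pow_nnnorm_pow_one_div_tendsto_nhds_spectralRadius a).eventually_lt_const hs,
      eventually_gt_atTop 0] with n hn hn0
    have h : ‖a ^ n‖₊ ≤ s ^ n := by
      have hn0' : (0 : ℝ) < n := by exact_mod_cast hn0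
      have := (ENNReal.rpow_le_rpow_iff hn0').2 hn.le
      rw [← ENNReal.rpow_mul, one_div_mul_cancel hn0'.ne', ENNReal.rpow_one,
        ENNReal.rpow_natCast] at this
      exact_mod_cast this
    have h' : ‖a ^ n‖ ≤ (s : ℝ) ^ n := by exact_mod_cast h
    rw [norm_smul, norm_pow, norm_inv, Complex.norm_real, Real.norm_of_nonneg r.coe_nonneg,
      NNReal.coe_div, div_eq_inv_mul, mul_pow]
    gcongr
  refine Summable.of_norm_bounded_eventually_nat (summable_geometric_of_lt_one (by positivity) ?_)
    hev
  exact_mod_cast (div_lt_one hr0).2 hsr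

open scoped NNReal in
/-- A positive map of spectral radius less than `r` admits a positive invertible element `b` with
`φ b ≤ r b`, namely the sum of the series `∑ r⁻ⁿ φⁿ 1`. -/
theorem ContinuousLinearMap.exists_isUnit_apply_le {A : Type*} [CStarAlgebra A] [PartialOrder A]
    [StarOrderedRing A] (φ : A →L[ℂ] A) (hφ : ∀ a : A, 0 ≤ a → 0 ≤ φ a) {r : ℝ≥0}
    (hr : spectralRadius ℂ φ < r) :
    ∃ b : A, 0 ≤ b ∧ IsUnit b ∧ φ b ≤ algebraMap ℝ A r * b := by
  have hr0 : 0 < r := ENNReal.coe_pos.1 (bot_le.trans_lt hr)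
  have hrc : ((r : ℝ) : ℂ) ≠ 0 := by exact_mod_cast hr0.ne'
  let f (n : ℕ) : A := ((r : ℝ) : ℂ)⁻¹ ^ n • (φ ^ n) 1
  have hf : Summable f :=
    (spectrum.summable_smul_pow_of_spectralRadius_lt φ hr).map
      (ContinuousLinearMap.apply ℂ A (1 : A)) (ContinuousLinearMap.apply ℂ A (1 : A)).continuous
  have hpos (n : ℕ) : 0 ≤ (φ ^ n) 1 := by
    induction n with
    | zero => simp
    | succ n ih => rw [pow_succ']; exact hφ _ ih
  have hf0 (n : ℕ) : 0 ≤ f n := by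
    have : f n = ((r : ℝ)⁻¹ ^ n) • (φ ^ n) 1 := by
      rw [← Complex.coe_smul]
      simp [f]
    rw [this]
    exact smul_nonneg (by positivity) (hpos n)
  have hφf (n : ℕ) : φ (f n) = ((r : ℝ) : ℂ) • f (n + 1) := by
    simp only [f, map_smul, smul_smul, pow_succ' φ, pow_succ' ((r : ℝ) : ℂ)⁻¹]
    rw [← mul_assoc, mul_inv_cancel₀ hrc, one_mul]
    rfl
  have hone : 1 ≤ ∑' n, f n := by
    simpa [f] using hf.le_tsum 0 fun n _ ↦ hf0 n
  have hnn : 0 ≤ ∑' n, f n := zero_le_one.trans hone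
  refine ⟨∑' n, f n, hnn, CStarAlgebra.isUnit_of_le 1 hone, ?_⟩
  have hsucc : ∑' n, f (n + 1) ≤ ∑' n, f n := by
    rw [hf.tsum_eq_zero_add]
    exact le_add_of_nonneg_left (hf0 0)
  rw [φ.map_tsum hf]
  simp_rw [hφf]
  rw [((summable_nat_add_iff 1).2 hf).tsum_const_smul, ← Algebra.smul_def]
  rw [Complex.coe_smul]
  exact smul_le_smul_of_nonneg_left hsucc r.coe_nonneg

/-- The spectral radius of a positive map `φ` on a unital C*-algebra equals the infimum of
`‖α_v⁻¹ ∘ φ ∘ α_v‖` over strictly positive (positive invertible) `v`, where `α_v x = v* x v`. -/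
theorem stmt2 {A : Type*} [CStarAlgebra A] [PartialOrder A] [StarOrderedRing A]
    (φ : A →L[ℂ] A) (hφ : ∀ a : A, 0 ≤ a → 0 ≤ φ a) :
    spectralRadius ℂ φ =
      ⨅ v : {v : Aˣ // 0 ≤ (v : A)},
        ENNReal.ofReal
          ‖(ContinuousLinearMap.mulLeftRight ℂ A (star ((↑(v : Aˣ)⁻¹ : A))) (↑(v : Aˣ)⁻¹ : A)).comp
            (φ.comp (ContinuousLinearMap.mulLeftRight ℂ A (star ((v : Aˣ) : A)) ((v : Aˣ) : A)))‖ := by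
  apply le_antisymm
  · refine le_iInf fun ⟨v, _⟩ ↦ ?_
    nontriviality A
    let U : (A →L[ℂ] A)ˣ :=
      { val := ContinuousLinearMap.mulLeftRight ℂ A (star (v : A)) (v : A)
        inv := ContinuousLinearMap.mulLeftRight ℂ A (star (↑v⁻¹ : A)) (↑v⁻¹ : A)
        val_inv := by
          ext x
          simp [← mul_assoc, ← star_mul]
        inv_val := by
          ext x
          simp [← mul_assoc, ← star_mul] }
    have hU : spectralRadius ℂ (↑U⁻¹ * φ * ↑U) = spectralRadius ℂ φ := by
      simp only [spectralRadius, spectrum.units_conjugate']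
    rw [← hU, ofReal_norm]
    exact spectrum.spectralRadius_le_nnnorm _
  · refine le_of_forall_gt_imp_ge_of_dense fun s hs ↦ ?_
    obtain ⟨r, hr, hrs⟩ := ENNReal.lt_iff_exists_nnreal_btwn.1 hs
    refine le_trans ?_ hrs.le
    obtain ⟨b, hb0, hbu, hb⟩ := φ.exists_isUnit_apply_le hφ hr
    have hss := CFC.sqrt_mul_sqrt_self b hb0
    have hvu : IsUnit (CFC.sqrt b) := by
      rw [← hss, (Commute.refl _).isUnit_mul_iff] at hbu
      exact hbu.1
    obtain ⟨v, hv⟩ := hvu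
    have hv0 : 0 ≤ (v : A) := hv ▸ CFC.sqrt_nonneg b
    have hvs : star (v : A) = v := hv0.isSelfAdjoint.star_eq
    rw [← hv] at hss
    refine (iInf_le _ ⟨v, hv0⟩).trans ?_
    rw [← ENNReal.ofReal_coe_nnreal]
    refine ENNReal.ofReal_le_ofReal ((ContinuousLinearMap.opNorm_le_norm_apply_one _ ?_).trans ?_)
    · intro a ha
      simpa using star_left_conjugate_nonneg (hφ _ (star_left_conjugate_nonneg ha (v : A)))
        (↑v⁻¹ : A)
    · have hle := star_left_conjugate_le_conjugate hb (↑v⁻¹ : A)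
      have heq : star (↑v⁻¹ : A) * (algebraMap ℝ A r * b) * ↑v⁻¹ = algebraMap ℝ A r := by
        rw [← mul_assoc, ← Algebra.commutes, mul_assoc, mul_assoc, ← hss]
        nth_rw 1 [← hvs]
        simp [← star_mul]
      have h0 : 0 ≤ star (↑v⁻¹ : A) * φ b * ↑v⁻¹ := star_left_conjugate_nonneg (hφ b hb0) _
      rw [heq, ← CStarAlgebra.norm_le_iff_le_algebraMap _ r.coe_nonneg h0] at hle
      simpa [hvs, hss] using hle
end

section
/- Let φ be a positive linear map on a unital C*-algebra A with r = r(φ). If there exists a strictly positive w ∈ A with φ(w) ≤ r·w, then v = w^{1/2} is strictly positive and ‖α_v⁻¹ ∘ φ ∘ α_v‖ = r. -/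
namespace CStarAlgebra

variable {A : Type*} [CStarAlgebra A]

section Order

variable [PartialOrder A] [StarOrderedRing A]

open scoped WithCStarModule in
/-- Multiplying the terms of a sum of nonnegative elements by scalars of modulus one does not
increase the norm of the sum. -/
lemma norm_sum_smul_le_of_nonneg_s5 {ι : Type*} [Fintype ι] (a : ι → A) (ha : ∀ i, 0 ≤ a i)
    (z : ι → ℂ) (hz : ∀ i, ‖z i‖ = 1) : ‖∑ i, z i • a i‖ ≤ ‖∑ i, a i‖ := by
  let x : C⋆ᵐᵒᵈ(A, ι → A) := (WithCStarModule.equiv A (ι → A)).symm fun i ↦ CFC.sqrt (a i)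
  let y : C⋆ᵐᵒᵈ(A, ι → A) :=
    (WithCStarModule.equiv A (ι → A)).symm fun i ↦ z i • CFC.sqrt (a i)
  have hs (i : ι) : star (CFC.sqrt (a i)) = CFC.sqrt (a i) :=
    (CFC.sqrt_nonneg (a i)).isSelfAdjoint.star_eq
  have hq (i : ι) : CFC.sqrt (a i) * CFC.sqrt (a i) = a i := CFC.sqrt_mul_sqrt_self _ (ha i)
  have hxy : inner A x y = ∑ i, z i • a i := by
    simp [x, y, WithCStarModule.pi_inner, WithCStarModule.inner_def, hs, hq]
  have hxx : inner A x x = ∑ i, a i := by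
    simp [x, WithCStarModule.pi_inner, WithCStarModule.inner_def, hs, hq]
  have hyy : inner A y y = ∑ i, a i := by
    have h1 (i : ι) : (starRingEnd ℂ) (z i) * z i = 1 := by
      rw [← Complex.normSq_eq_conj_mul_self, Complex.normSq_eq_norm_sq, hz]; simp
    simp [y, WithCStarModule.pi_inner, WithCStarModule.inner_def, hs, hq, smul_smul, h1]
  have hx : ‖x‖ ^ 2 = ‖∑ i, a i‖ := by rw [CStarModule.norm_sq_eq (A := A), hxx]
  have hy : ‖y‖ ^ 2 = ‖∑ i, a i‖ := by rw [CStarModule.norm_sq_eq (A := A), hyy]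
  have key := CStarModule.norm_inner_le (A := A) (C⋆ᵐᵒᵈ(A, ι → A)) (x := x) (y := y)
  rw [hxy] at key
  nlinarith [sq_nonneg (‖x‖ - ‖y‖)]

open scoped ComplexOrder in
/-- A unitary is approximated by combinations, with coefficients of modulus one, of nonnegative
elements that sum to `1`. -/
lemma exists_norm_sub_sum_smul_le (u : unitary A) {ε : ℝ} (hε : 0 < ε) :
    ∃ (s : Finset ℂ) (p : s → A), (∀ i : s, ‖(i : ℂ)‖ = 1) ∧ (∀ i, 0 ≤ p i) ∧ ∑ i, p i = 1 ∧
      ‖(u : A) - ∑ i : s, (i : ℂ) • p i‖ ≤ ε := by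
  obtain ⟨t, hts, htf, htc⟩ := (isCompact_sphere (0 : ℂ) 1).finite_cover_balls hε
  let s := htf.toFinset
  let h (c z : ℂ) : ℝ := max 0 (ε - ‖z - c‖)
  let d (z : ℂ) : ℝ := ∑ c : s, h c z
  have h0 (c z : ℂ) : 0 ≤ h c z := le_max_left _ _
  have hsp : spectrum ℂ (u : A) ⊆ Metric.sphere 0 1 :=
    spectrum.subset_circle_of_unitary u.2
  have hd (z : ℂ) (hz : z ∈ spectrum ℂ (u : A)) : 0 < d z := by
    obtain ⟨c, hc, hzc⟩ := Set.mem_iUnion₂.1 (htc (hsp hz))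
    refine Finset.sum_pos' (fun _ _ ↦ h0 _ _) ⟨⟨c, htf.mem_toFinset.2 hc⟩, Finset.mem_univ _, ?_⟩
    rw [Metric.mem_ball, dist_eq_norm] at hzc
    exact lt_max_of_lt_right (by simpa using hzc)
  have hcont (c : ℂ) : Continuous (h c) := by fun_prop
  have hdcont : Continuous d := by fun_prop
  let f (c z : ℂ) : ℂ := ((h c z / d z : ℝ) : ℂ)
  have hf (c : ℂ) : ContinuousOn (f c) (spectrum ℂ (u : A)) :=
    Complex.continuous_ofReal.comp_continuousOn
      ((hcont c).continuousOn.div hdcont.continuousOn fun z hz ↦ (hd z hz).ne')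
  have hd1 (z : ℂ) (hz : z ∈ spectrum ℂ (u : A)) : ∑ c : s, h c z / d z = 1 := by
    rw [← Finset.sum_div]
    exact div_self (hd z hz).ne'
  have hf1 (z : ℂ) (hz : z ∈ spectrum ℂ (u : A)) : ∑ c : s, f c z = 1 := by
    simp only [f]
    exact_mod_cast hd1 z hz
  have hu : IsStarNormal (u : A) := inferInstance
  refine ⟨s, fun c ↦ cfc (f c) (u : A), fun c ↦ ?_, fun c ↦ ?_, ?_, ?_⟩
  · simpa using hts (htf.mem_toFinset.1 c.2)
  · refine cfc_nonneg fun z hz ↦ ?_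
    exact Complex.zero_le_real.2 (div_nonneg (h0 c z) (hd z hz).le)
  · rw [← cfc_sum_univ (fun c : s ↦ f c) (u : A) (fun c ↦ hf c), ← cfc_const_one ℂ (u : A)]
    exact cfc_congr fun z hz ↦ by simpa using hf1 z hz
  · have hsum : (u : A) - ∑ c : s, (c : ℂ) • cfc (f c) (u : A)
        = cfc (fun z ↦ z - ∑ c : s, (c : ℂ) * f c z) (u : A) := by
      rw [cfc_sub (fun z : ℂ ↦ z) (fun z ↦ ∑ c : s, (c : ℂ) * f c z) (u : A) (by fun_prop)
        (continuousOn_finsetSum _ fun c _ ↦ continuousOn_const.mul (hf c)), cfc_id' ℂ (u : A)]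
      congr 1
      have := cfc_sum_univ (fun (c : s) (z : ℂ) ↦ (c : ℂ) * f c z) (u : A)
        (fun c ↦ continuousOn_const.mul (hf c))
      simp only [cfc_const_mul _ _ _ (hf _)] at this
      rw [← this]
      congr 1
      ext z
      simp
    rw [hsum]
    refine norm_cfc_le hε.le fun z hz ↦ ?_
    have e : z - ∑ c : s, (c : ℂ) * f c z = ∑ c : s, (z - c) * f c z := by
      simp only [sub_mul, Finset.sum_sub_distrib, ← Finset.mul_sum, hf1 z hz, mul_one]
    rw [e]
    calc ‖∑ c : s, (z - c) * f c z‖ ≤ ∑ c : s, ε * (h c z / d z) := by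
          refine norm_sum_le_of_le _ fun c _ ↦ ?_
          have hn : 0 ≤ h c z / d z := div_nonneg (h0 c z) (hd z hz).le
          rw [norm_mul, Complex.norm_real, Real.norm_of_nonneg hn]
          rcases le_or_gt ‖z - c‖ ε with hle | hlt
          · gcongr
          · have : h c z = 0 := max_eq_left (by linarith)
            simp [this]
      _ = ε := by rw [← Finset.mul_sum, hd1 z hz, mul_one]

/-- An invertible contraction is the mean of two unitaries. -/
lemma exists_unitary_add_unitary_of_isUnit (a : A) (ha : IsUnit a) (ha1 : ‖a‖ ≤ 1) :
    ∃ u₁ u₂ : unitary A, (2 : ℝ) • a = u₁ + u₂ := by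
  have hpp : CFC.abs a * CFC.abs a = star a * a := CFC.abs_mul_abs a
  have hp0 : 0 ≤ CFC.abs a := CFC.abs_nonneg a
  have hpu : IsUnit (CFC.abs a) := by
    rw [CFC.abs, CFC.isUnit_sqrt_iff _ (star_mul_self_nonneg a)]
    exact ha.star.mul ha
  obtain ⟨p, hp⟩ := hpu
  obtain ⟨b, rfl⟩ := ha
  rw [← hp] at hpp hp0
  have hps : star p = p := Units.ext hp0.isSelfAdjoint.star_eq
  have hpn : ‖(p : A)‖ ≤ 1 := by
    rw [hp, CFC.norm_abs]
    exact ha1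
  have hpp' : p * p = star b * b := Units.ext hpp
  have hw : star (b * p⁻¹) * (b * p⁻¹) = 1 := by
    rw [star_mul, star_inv, hps, mul_assoc, ← mul_assoc (star b), ← hpp']
    group
  have hw' : (b * p⁻¹) * star (b * p⁻¹) = 1 := mul_eq_one_comm.1 hw
  let w : unitary A := ⟨((b * p⁻¹ : Aˣ) : A), by
    rw [Unitary.mem_iff]
    exact ⟨congrArg Units.val hw, congrArg Units.val hw'⟩⟩
  let s : unitary A := selfAdjoint.unitarySelfAddISMul ⟨(p : A), hp0.isSelfAdjoint⟩ hpn
  refine ⟨w * s, w * star s, ?_⟩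
  have hs : (s : A) + star (s : A) = (2 : ℝ) • (p : A) := by
    have := selfAdjoint.star_coe_unitarySelfAddISMul ⟨(p : A), hp0.isSelfAdjoint⟩ hpn
    change star (s : A) = _ at this
    rw [this]
    change (p : A) + Complex.I • CFC.sqrt (1 - (p : A) ^ 2) + _ = _
    rw [two_smul]
    abel
  have hwp : (w : A) * p = b := by simp [w]
  push_cast
  rw [← mul_add, hs, mul_smul_comm, hwp]

/-- The sum of a unitary and a strict contraction is the sum of two unitaries. -/
lemma exists_unitary_add_unitary (u : unitary A) (y : A) (hy : ‖y‖ < 1) :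
    ∃ u₁ u₂ : unitary A, (u : A) + y = u₁ + u₂ := by
  obtain (_ | _) := subsingleton_or_nontrivial A
  · exact ⟨1, 1, Subsingleton.elim _ _⟩
  have hn : ‖star (u : A) * y‖ < 1 := by
    rwa [← Unitary.coe_star, CStarRing.norm_coe_unitary_mul]
  have h1 : IsUnit (1 + star (u : A) * y) := by
    simpa using isUnit_one_sub_of_norm_lt_one (x := -(star (u : A) * y)) (by rwa [norm_neg])
  obtain ⟨u₁, u₂, h⟩ := exists_unitary_add_unitary_of_isUnit
    ((2⁻¹ : ℝ) • (1 + star (u : A) * y)) (h1.smul (Units.mk0 (2⁻¹ : ℝ) (by norm_num))) (by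
      rw [norm_smul]
      have := norm_add_le (1 : A) (star (u : A) * y)
      rw [CStarRing.norm_one] at this
      norm_num
      linarith)
  refine ⟨u * u₁, u * u₂, ?_⟩
  rw [smul_smul, mul_inv_cancel₀ two_ne_zero, one_smul] at h
  push_cast
  rw [← mul_add, ← h, mul_add, ← mul_assoc]
  simp

/-- A quantitative form of the **Russo–Dye theorem**: a linear map on a unital C⋆-algebra which is
bounded by `M` on the unitaries has norm at most `M`. -/
lemma opNorm_le_of_unitary {E : Type*} [NormedAddCommGroup E] [NormedSpace ℂ E] (f : A →L[ℂ] E)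
    {M : ℝ} (hM : ∀ u : unitary A, ‖f u‖ ≤ M) : ‖f‖ ≤ M := by
  have bound (y : A) (hy : ‖y‖ < 1) (n : ℕ) :
      ∀ u : unitary A, ‖f (u + n • y)‖ ≤ (n + 1) * M := by
    induction n with
    | zero => simpa using hM
    | succ n ih =>
      intro u
      obtain ⟨u₁, u₂, h⟩ := exists_unitary_add_unitary u y hy
      have e : (u : A) + (n + 1) • y = u₁ + (u₂ + n • y) := by
        rw [← add_assoc, ← h, succ_nsmul]
        abel
      rw [e, map_add]
      push_cast
      linarith [norm_add_le (f u₁) (f (u₂ + n • y)), hM u₁, ih u₂]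
  have hball (y : A) (hy : ‖y‖ < 1) : ‖f y‖ ≤ M := by
    by_contra! hlt
    obtain ⟨n, hn⟩ := exists_nat_gt (2 * M / (‖f y‖ - M))
    rw [div_lt_iff₀ (by linarith)] at hn
    have h1 := bound y hy n 1
    have h2 := hM 1
    have h3 : n * ‖f y‖ ≤ ‖f ((1 : unitary A) + n • y)‖ + ‖f (1 : unitary A)‖ := by
      have := norm_sub_le (f ((1 : unitary A) + n • y)) (f (1 : unitary A))
      rwa [← map_sub, add_sub_cancel_left, map_nsmul, ← Nat.cast_smul_eq_nsmul ℝ, norm_smul,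
        Real.norm_natCast] at this
    linarith
  rw [← f.sSup_unit_ball_eq_norm]
  refine csSup_le ((Metric.nonempty_ball.2 one_pos).image _) ?_
  rintro _ ⟨y, hy, rfl⟩
  exact hball y (mem_ball_zero_iff.1 hy)

/-- A positive map on a unital C⋆-algebra attains its norm at `1`. -/
lemma opNorm_le_norm_apply_one {B : Type*} [CStarAlgebra B] [PartialOrder B] [StarOrderedRing B]
    (f : A →L[ℂ] B) (hf : ∀ a, 0 ≤ a → 0 ≤ f a) : ‖f‖ ≤ ‖f 1‖ := by
  refine opNorm_le_of_unitary f fun u ↦ le_of_forall_pos_le_add fun δ hδ ↦ ?_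
  obtain ⟨s, p, hs, hp, hp1, hup⟩ :=
    exists_norm_sub_sum_smul_le u (ε := δ / (‖f‖ + 1)) (by positivity)
  have h1 : ‖f (u - ∑ i : s, (i : ℂ) • p i)‖ ≤ δ := by
    refine (f.le_opNorm_of_le hup).trans ?_
    rw [mul_div_assoc', div_le_iff₀ (by positivity)]
    nlinarith
  have h2 : ‖f (∑ i : s, (i : ℂ) • p i)‖ ≤ ‖f 1‖ := by
    rw [← hp1]
    simp only [map_sum, map_smul]
    exact norm_sum_smul_le_of_nonneg_s5 _ (fun i ↦ hf _ (hp i)) _ hs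
  have h3 := norm_add_le (f (u - ∑ i : s, (i : ℂ) • p i)) (f (∑ i : s, (i : ℂ) • p i))
  rw [← map_add, sub_add_cancel] at h3
  linarith

end Order

end CStarAlgebra

/-- If `φ` is positive with spectral radius `r` and `φ(w) ≤ r w` for some strictly positive `w`,
then `v = w^{1/2}` is strictly positive and `‖α_v⁻¹ ∘ φ ∘ α_v‖ = r`. -/
theorem stmt5 {A : Type*} [CStarAlgebra A] [PartialOrder A] [StarOrderedRing A]
    (φ : A →L[ℂ] A) (hφ : ∀ a : A, 0 ≤ a → 0 ≤ φ a)
    (r : ℝ) (hr0 : 0 ≤ r) (hr : spectralRadius ℂ φ = ENNReal.ofReal r)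
    (w : Aˣ) (hw : 0 ≤ (w : A)) (hw2 : φ (w : A) ≤ (r : ℂ) • (w : A)) :
    ∃ v : Aˣ, 0 ≤ (v : A) ∧ (v : A) * (v : A) = (w : A) ∧
      ‖(ContinuousLinearMap.mulLeftRight ℂ A (star ((↑v⁻¹ : A))) (↑v⁻¹ : A)).comp
        (φ.comp (ContinuousLinearMap.mulLeftRight ℂ A (star (v : A)) (v : A)))‖ = r := by
  obtain ⟨v, hv⟩ := (CFC.isUnit_sqrt_iff (w : A) hw).2 w.isUnit
  have hv0 : 0 ≤ (v : A) := hv ▸ CFC.sqrt_nonneg _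
  have hvv : (v : A) * v = w := by rw [hv, CFC.sqrt_mul_sqrt_self _ hw]
  have hvs : star v = v := Units.ext hv0.isSelfAdjoint.star_eq
  have hvs' : star (v : A) = v := hv0.isSelfAdjoint.star_eq
  have hvi : star (↑v⁻¹ : A) = ↑v⁻¹ := by
    rw [← Units.coe_star, star_inv, hvs]
  refine ⟨v, hv0, hvv, ?_⟩
  rw [hvs', hvi]
  let α (x : Aˣ) : A →L[ℂ] A := ContinuousLinearMap.mulLeftRight ℂ A x x
  have hα (x : Aˣ) (a : A) : α x a = x * a * x := ContinuousLinearMap.mulLeftRight_apply ..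
  let e : (A →L[ℂ] A)ˣ :=
    { val := α v
      inv := α v⁻¹
      val_inv := by
        ext a
        simp [hα, mul_assoc]
      inv_val := by
        ext a
        simp [hα, mul_assoc] }
  change ‖(e⁻¹ : (A →L[ℂ] A)ˣ).val * (φ * e.val)‖ = r
  rw [← mul_assoc]
  set ψ : A →L[ℂ] A := (e⁻¹ : (A →L[ℂ] A)ˣ).val * φ * e.val with hψ
  have hψa (a : A) : ψ a = ↑v⁻¹ * φ (v * a * v) * ↑v⁻¹ := by
    change α v⁻¹ (φ (α v a)) = _
    rw [hα, hα]
  have hspec : spectralRadius ℂ ψ = ENNReal.ofReal r := by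
    rw [← hr, spectralRadius, spectralRadius, hψ, spectrum.units_conjugate']
  apply le_antisymm
  · refine (CStarAlgebra.opNorm_le_norm_apply_one ψ fun a ha ↦ ?_).trans ?_
    · rw [hψa]
      have h1 := hφ _ (star_left_conjugate_nonneg ha (v : A))
      have h2 := star_left_conjugate_nonneg h1 (↑v⁻¹ : A)
      rwa [hvs', hvi] at h2
    · have hψ1 : ψ 1 = ↑v⁻¹ * φ w * ↑v⁻¹ := by rw [hψa, mul_one, hvv]
      have h0 : 0 ≤ ψ 1 := by
        have h2 := star_left_conjugate_nonneg (hφ _ hw) (↑v⁻¹ : A)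
        rwa [hvi, ← hψ1] at h2
      rw [CStarAlgebra.norm_le_iff_le_algebraMap (ψ 1) hr0 h0]
      have h2 := star_left_conjugate_le_conjugate hw2 (↑v⁻¹ : A)
      rw [hvi, ← hψ1, ← hvv] at h2
      simpa [mul_assoc, Algebra.algebraMap_eq_smul_one] using h2
  · obtain (_ | _) := subsingleton_or_nontrivial A
    · have : r ≤ 0 := by
        rw [← ENNReal.ofReal_eq_zero, ← hr, Subsingleton.elim φ 0]
        simp
      exact this.trans (norm_nonneg _)
    · have h := spectrum.spectralRadius_le_nnnorm (𝕜 := ℂ) ψ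
      rw [hspec] at h
      rw [← coe_nnnorm]
      exact (ENNReal.ofReal_le_coe).1 h
end

section
/- Let τ : M_n(ℂ) → M_n(ℂ) be a completely positive map with Choi-Kraus decomposition τ(X) = Σ_{i=1}^p A_i* X A_i. Then a matrix A ∈ M_n(ℂ) lies in the linear span of {A_1, ..., A_p} if and only if there exists q > 0 such that qτ - α_A is completely positive, where α_A(X) = A*XA. -/
open Matrix in
/-- Pairing the Choi matrix of `X ↦ Mᴴ * X * M` with a linear functional `f` gives `‖f M‖ ^ 2`. -/
theorem sum_star_mul_conjTranspose_mul_single_mul_apply {n : ℕ}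
    (f : Matrix (Fin n) (Fin n) ℂ →ₗ[ℂ] ℂ) (M : Matrix (Fin n) (Fin n) ℂ) :
    ∑ a, ∑ c, ∑ b, ∑ d, star (f (single a c 1)) * f (single b d 1) *
      (Mᴴ * single a b (1 : ℂ) * M : Matrix (Fin n) (Fin n) ℂ) c d = ((‖f M‖ ^ 2 : ℝ) : ℂ) := by
  have hf : f M = ∑ a, ∑ c, M a c * f (single a c 1) := by
    conv_lhs => rw [matrix_eq_sum_single M]
    simp only [map_sum]
    refine Finset.sum_congr rfl fun a _ => Finset.sum_congr rfl fun c _ => ?_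
    rw [← smul_eq_mul, ← map_smul, smul_single, smul_eq_mul, mul_one]
  have hM (a b c d) : (Mᴴ * single a b (1 : ℂ) * M) c d = star (M a c) * M b d := by
    rw [mul_apply, Finset.sum_eq_single b]
    · simp
    · intro x _ hx
      simp [hx]
    · simp
  have hsq : ((‖f M‖ ^ 2 : ℝ) : ℂ) = f M * star (f M) := by
    push_cast
    exact (Complex.mul_conj' _).symm
  rw [hsq, hf]
  simp only [star_sum, Finset.sum_mul, Finset.mul_sum, hM, star_mul']
  refine Finset.sum_congr rfl fun a _ => Finset.sum_congr rfl fun c _ =>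
    Finset.sum_congr rfl fun b _ => Finset.sum_congr rfl fun d _ => ?_
  ring

open Matrix in
/-- A matrix whose conjugation map is dominated by a multiple of a completely positive map lies in
the span of the Kraus coefficients of that map. -/
theorem mem_span_range_of_kraus_dominated {n p k : ℕ} {A : Fin p → Matrix (Fin n) (Fin n) ℂ}
    {B : Matrix (Fin n) (Fin n) ℂ} {q : ℝ} {C : Fin k → Matrix (Fin n) (Fin n) ℂ}
    (h : ∀ X, (q : ℂ) • ∑ i, (A i)ᴴ * X * A i - Bᴴ * X * B = ∑ j, (C j)ᴴ * X * C j) :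
    B ∈ Submodule.span ℂ (Set.range A) := by
  by_contra hB
  obtain ⟨f, hfB, hf⟩ := Submodule.exists_le_ker_of_notMem hB
  have hfA (i) : f (A i) = 0 := hf (Submodule.subset_span ⟨i, rfl⟩)
  let Φ : (Matrix (Fin n) (Fin n) ℂ → Matrix (Fin n) (Fin n) ℂ) →ₗ[ℂ] ℂ :=
    { toFun := fun T => ∑ a, ∑ c, ∑ b, ∑ d, star (f (single a c 1)) * f (single b d 1) *
        T (single a b 1) c d
      map_add' := fun S T => by
        simp only [Pi.add_apply, Matrix.add_apply, mul_add, Finset.sum_add_distrib]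
      map_smul' := fun r T => by
        simp only [Pi.smul_apply, Matrix.smul_apply, smul_eq_mul, Finset.mul_sum, RingHom.id_apply,
          mul_left_comm] }
  have hΦ (M : Matrix (Fin n) (Fin n) ℂ) : Φ (fun X => Mᴴ * X * M) = ((‖f M‖ ^ 2 : ℝ) : ℂ) :=
    sum_star_mul_conjTranspose_mul_single_mul_apply f M
  have hfun : (q : ℂ) • ∑ i, (fun X => (A i)ᴴ * X * A i) - (fun X => Bᴴ * X * B) =
      ∑ j, fun X => (C j)ᴴ * X * C j := by
    funext X
    simpa using h X
  have key := congrArg Φ hfun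
  simp only [map_sub, map_smul, map_sum, hΦ, hfA] at key
  have key' : -‖f B‖ ^ 2 = ∑ j, ‖f (C j)‖ ^ 2 := by
    simp at key
    exact_mod_cast key
  have h1 : 0 ≤ ∑ j, ‖f (C j)‖ ^ 2 := by positivity
  have h2 : 0 < ‖f B‖ := norm_pos_iff.mpr hfB
  nlinarith

open Matrix in
/-- Lagrange's identity for conjugation by a linear combination of matrices. -/
theorem sum_conjTranspose_smul_sub_smul_mul_mul {n p : ℕ} (A : Fin p → Matrix (Fin n) (Fin n) ℂ)
    (c : Fin p → ℂ) (X : Matrix (Fin n) (Fin n) ℂ) :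
    ∑ i, ∑ j, (star (c i) • A j - star (c j) • A i)ᴴ * X * (star (c i) • A j - star (c j) • A i) =
      (2 : ℂ) • ((∑ i, c i * star (c i)) • ∑ j, (A j)ᴴ * X * A j -
        (∑ i, c i • A i)ᴴ * X * ∑ i, c i • A i) := by
  have expand (i j) :
      (star (c i) • A j - star (c j) • A i)ᴴ * X * (star (c i) • A j - star (c j) • A i) =
        (c i * star (c i)) • ((A j)ᴴ * X * A j) + (c j * star (c j)) • ((A i)ᴴ * X * A i) -
        (star (c j) * c i) • ((A j)ᴴ * X * A i) - (star (c i) * c j) • ((A i)ᴴ * X * A j) := by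
    simp only [conjTranspose_sub, conjTranspose_smul, star_star, sub_mul, mul_sub, smul_mul_assoc,
      mul_smul_comm]
    module
  have cross : (∑ i, c i • A i)ᴴ * X * ∑ i, c i • A i =
      ∑ i, ∑ j, (star (c i) * c j) • ((A i)ᴴ * X * A j) := by
    simp only [conjTranspose_sum, conjTranspose_smul, Finset.sum_mul, Finset.mul_sum,
      smul_mul_assoc, mul_smul_comm, Finset.smul_sum, smul_smul]
    rw [Finset.sum_comm]
    simp only [mul_comm]
  have diag : (∑ i, c i * star (c i)) • ∑ j, (A j)ᴴ * X * A j =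
      ∑ i, ∑ j, (c i * star (c i)) • ((A j)ᴴ * X * A j) := by
    simp only [Finset.sum_smul, Finset.smul_sum]
    exact Finset.sum_comm
  simp only [expand, Finset.sum_sub_distrib, Finset.sum_add_distrib]
  rw [Finset.sum_comm (f := fun i j => (c j * star (c j)) • ((A i)ᴴ * X * A i)),
    Finset.sum_comm (f := fun i j => (star (c j) * c i) • ((A j)ᴴ * X * A i)), ← cross, ← diag]
  module

open Matrix in
/-- Conjugation by an element of the span of the Kraus coefficients of a completely positive map is
dominated by a multiple of that map. -/
theorem exists_kraus_dominated_of_mem_span_range {n p : ℕ} {A : Fin p → Matrix (Fin n) (Fin n) ℂ}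
    {B : Matrix (Fin n) (Fin n) ℂ} (hB : B ∈ Submodule.span ℂ (Set.range A)) :
    ∃ q : ℝ, 0 < q ∧ ∃ (k : ℕ) (C : Fin k → Matrix (Fin n) (Fin n) ℂ),
      ∀ X, (q : ℂ) • ∑ i, (A i)ᴴ * X * A i - Bᴴ * X * B = ∑ j, (C j)ᴴ * X * C j := by
  obtain ⟨c, rfl⟩ := (Submodule.mem_span_range_iff_exists_fun ℂ).mp hB
  let D : (Fin p × Fin p) ⊕ Fin p → Matrix (Fin n) (Fin n) ℂ :=
    Sum.elim (fun ij => ((√2⁻¹ : ℝ) : ℂ) • (star (c ij.1) • A ij.2 - star (c ij.2) • A ij.1)) A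
  refine ⟨∑ i, ‖c i‖ ^ 2 + 1, by positivity, _, D ∘ (Fintype.equivFin _).symm, fun X => ?_⟩
  have hq : ((∑ i, ‖c i‖ ^ 2 + 1 : ℝ) : ℂ) = ∑ i, c i * star (c i) + 1 := by
    push_cast
    congr 1
    exact Finset.sum_congr rfl fun i _ => (Complex.mul_conj' _).symm
  have hs : ((√2⁻¹ : ℝ) : ℂ) * ((√2⁻¹ : ℝ) : ℂ) = 2⁻¹ := by
    rw [← Complex.ofReal_mul, Real.mul_self_sqrt (by norm_num)]
    norm_num
  have hscale (M : Matrix (Fin n) (Fin n) ℂ) :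
      (((√2⁻¹ : ℝ) : ℂ) • M)ᴴ * X * (((√2⁻¹ : ℝ) : ℂ) • M) = (2⁻¹ : ℂ) • (Mᴴ * X * M) := by
    rw [conjTranspose_smul, smul_mul_assoc, smul_mul_assoc, mul_smul_comm, smul_smul,
      Complex.star_def, Complex.conj_ofReal, hs]
  have hsum := (Fintype.equivFin ((Fin p × Fin p) ⊕ Fin p)).symm.sum_comp
    fun x => (D x)ᴴ * X * D x
  simp only [Function.comp_apply]
  rw [hsum, Fintype.sum_sum_type, Fintype.sum_prod_type, hq]
  simp only [D, Sum.elim_inl, Sum.elim_inr, hscale, ← Finset.smul_sum]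
  rw [sum_conjTranspose_smul_sub_smul_mul_mul, smul_smul]
  norm_num
  module


open Matrix in
/-- For a CP map `τ(X) = Σ Aᵢ* X Aᵢ` on `M_n(ℂ)`, a matrix `B` lies in the span of the Kraus
coefficients `Aᵢ` iff `q τ - α_B` is completely positive (i.e. admits a Kraus decomposition)
for some `q > 0`, where `α_B(X) = B* X B`. -/
theorem stmt7 {n p : ℕ} (A : Fin p → Matrix (Fin n) (Fin n) ℂ)
    (τ : Matrix (Fin n) (Fin n) ℂ →ₗ[ℂ] Matrix (Fin n) (Fin n) ℂ)
    (hτ : ∀ X, τ X = ∑ i, (A i)ᴴ * X * A i)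
    (B : Matrix (Fin n) (Fin n) ℂ) :
    B ∈ Submodule.span ℂ (Set.range A) ↔
      ∃ q : ℝ, 0 < q ∧ ∃ (k : ℕ) (C : Fin k → Matrix (Fin n) (Fin n) ℂ),
        ∀ X, (q : ℂ) • τ X - Bᴴ * X * B = ∑ j, (C j)ᴴ * X * C j := by
  simp only [hτ]
  exact ⟨exists_kraus_dominated_of_mem_span_range,
    fun ⟨_, _, _, _, h⟩ => mem_span_range_of_kraus_dominated h⟩
end

section
/- Let A ∈ M_m(ℂ) with spectral radius r(A) = 1. If there exists M > 0 such that ‖Aⁿ‖ ≤ M for all n ∈ ℕ, then there exists an invertible P ∈ M_m(ℂ) such that ‖P A P⁻¹‖ = 1 (operator norm). -/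
section PowerBounded

open scoped InnerProductSpace ComplexOrder

variable {E : Type*} [NormedAddCommGroup E]

/-- A bounded orbit excludes Jordan blocks of size two for eigenvalues of modulus at least one. -/
theorem eq_zero_of_bounded_orbit_of_jordan_block [NormedSpace ℂ E] (L : Module.End ℂ E) {μ : ℂ}
    (hμ : 1 ≤ ‖μ‖) {u v : E} (hu : L u = μ • u + v) (hv : L v = μ • v) {C : ℝ}
    (hC : ∀ n : ℕ, ‖(L ^ n) u‖ ≤ C) : v = 0 := by
  have hμ0 : 0 < ‖μ‖ := by linarith
  have key (n : ℕ) : (L ^ (n + 1)) u = μ ^ n • (μ • u + ((n : ℂ) + 1) • v) := by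
    induction n with
    | zero => simp [hu]
    | succ n ih =>
      rw [pow_succ', Module.End.mul_apply, ih]
      simp only [map_smul, map_add, hu, hv]
      push_cast
      module
  have bound (n : ℕ) : ((n : ℝ) + 1) * ‖v‖ ≤ C + ‖μ‖ * ‖u‖ := by
    have h1 := hC (n + 1)
    rw [key, norm_smul, norm_pow] at h1
    have h2 : ‖μ • u + ((n : ℂ) + 1) • v‖ ≤ C :=
      (le_mul_of_one_le_left (norm_nonneg _) (one_le_pow₀ hμ)).trans h1
    have h3 : ‖((n : ℂ) + 1) • v‖ = ((n : ℝ) + 1) * ‖v‖ := by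
      rw [norm_smul]
      congr 1
      exact_mod_cast Complex.norm_natCast (n + 1)
    have h4 := norm_sub_le (μ • u + ((n : ℂ) + 1) • v) (μ • u)
    rw [add_sub_cancel_left, h3, norm_smul] at h4
    linarith
  by_contra hne
  have hpos : 0 < ‖v‖ := norm_pos_iff.mpr hne
  obtain ⟨n, hn⟩ := exists_nat_gt ((C + ‖μ‖ * ‖u‖) / ‖v‖)
  rw [div_lt_iff₀ hpos] at hn
  nlinarith [bound n]

/-- For a power bounded operator, generalized eigenvectors for an eigenvalue of modulus at least
one are eigenvectors. -/
theorem map_eq_smul_of_bounded_orbits [NormedSpace ℂ E] (L : Module.End ℂ E)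
    (hL : ∀ u, ∃ C : ℝ, ∀ n : ℕ, ‖(L ^ n) u‖ ≤ C) {μ : ℂ} (hμ : 1 ≤ ‖μ‖) (k : ℕ) (u : E)
    (hu : ((L - μ • (1 : Module.End ℂ E)) ^ k) u = 0) : L u = μ • u := by
  induction k generalizing u with
  | zero =>
    have : u = 0 := by simpa using hu
    simp [this]
  | succ k ih =>
    have hv : L (L u - μ • u) = μ • (L u - μ • u) := by
      apply ih
      simpa [pow_succ] using hu
    obtain ⟨C, hC⟩ := hL u
    have := eq_zero_of_bounded_orbit_of_jordan_block L hμ (u := u) (by abel) hv hC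
    exact sub_eq_zero.mp this

/-- A nonzero eigenvector with a bounded orbit has an eigenvalue of modulus at most one. -/
theorem norm_le_one_of_bounded_orbit_of_eigenvector [NormedSpace ℂ E] (L : Module.End ℂ E) {μ : ℂ}
    {u : E} (hu0 : u ≠ 0) (hu : L u = μ • u) {C : ℝ} (hC : ∀ n : ℕ, ‖(L ^ n) u‖ ≤ C) :
    ‖μ‖ ≤ 1 := by
  by_contra! h
  have key (n : ℕ) : (L ^ n) u = μ ^ n • u := by
    induction n with
    | zero => simp
    | succ n ih => rw [pow_succ', Module.End.mul_apply, ih, map_smul, hu, smul_smul, pow_succ]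
  have hpos : 0 < ‖u‖ := norm_pos_iff.mpr hu0
  obtain ⟨n, hn⟩ := pow_unbounded_of_one_lt (C / ‖u‖) h
  rw [div_lt_iff₀ hpos] at hn
  have := hC n
  rw [key, norm_smul, norm_pow] at this
  linarith

variable [InnerProductSpace ℂ E]

theorem reApplyInnerSelf_rankOne_self (u x : E) :
    (InnerProductSpace.rankOne ℂ u u).reApplyInnerSelf x = ‖⟪u, x⟫_ℂ‖ ^ 2 := by
  rw [ContinuousLinearMap.reApplyInnerSelf_apply, InnerProductSpace.rankOne_apply, inner_smul_left,
    RCLike.conj_mul]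
  norm_cast

theorem reApplyInnerSelf_add (S T : E →L[ℂ] E) (x : E) :
    (S + T).reApplyInnerSelf x = S.reApplyInnerSelf x + T.reApplyInnerSelf x := by
  simp [ContinuousLinearMap.reApplyInnerSelf_apply, inner_add_left]

theorem reApplyInnerSelf_real_smul (c : ℝ) (T : E →L[ℂ] E) (x : E) :
    ((c : ℂ) • T).reApplyInnerSelf x = c * T.reApplyInnerSelf x := by
  rw [ContinuousLinearMap.reApplyInnerSelf_apply, ContinuousLinearMap.reApplyInnerSelf_apply,
    smul_apply, inner_smul_left, Complex.conj_ofReal]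
  exact Complex.re_ofReal_mul _ _

theorem reApplyInnerSelf_sum {ι : Type*} (s : Finset ι) (T : ι → E →L[ℂ] E) (x : E) :
    (∑ i ∈ s, T i).reApplyInnerSelf x = ∑ i ∈ s, (T i).reApplyInnerSelf x := by
  simp [ContinuousLinearMap.reApplyInnerSelf_apply, sum_inner]

theorem norm_mul_add_sq_le {μ : ℂ} (hμ : ‖μ‖ < 1) (a b : ℂ) :
    ‖μ * a + b‖ ^ 2 ≤ ‖μ‖ * ‖a‖ ^ 2 + (1 - ‖μ‖)⁻¹ * ‖b‖ ^ 2 := by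
  have hδ : 0 < 1 - ‖μ‖ := by linarith
  have h1 : ‖μ * a + b‖ ≤ ‖μ‖ * ‖a‖ + ‖b‖ := (norm_add_le _ _).trans_eq (by rw [norm_mul])
  have h2 : ‖μ‖ * ‖a‖ ^ 2 + (1 - ‖μ‖)⁻¹ * ‖b‖ ^ 2 - (‖μ‖ * ‖a‖ + ‖b‖) ^ 2
      = ‖μ‖ * (1 - ‖μ‖)⁻¹ * ((1 - ‖μ‖) * ‖a‖ - ‖b‖) ^ 2 := by
    field_simp
    ring
  have h3 : 0 ≤ ‖μ‖ * (1 - ‖μ‖)⁻¹ * ((1 - ‖μ‖) * ‖a‖ - ‖b‖) ^ 2 := by positivity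
  have h4 := pow_le_pow_left₀ (norm_nonneg _) h1 2
  linarith

/-- `u` is dominated by `T` if some Lyapunov function for `T` dominates `x ↦ |⟪u, x⟫|²`. -/
def LyapunovDominated (T : E →L[ℂ] E) (u : E) : Prop :=
  ∃ H : E →L[ℂ] E, H.IsPositive ∧ (∀ x, H.reApplyInnerSelf (T x) ≤ H.reApplyInnerSelf x) ∧
    ∀ x, ‖⟪u, x⟫_ℂ‖ ^ 2 ≤ H.reApplyInnerSelf x

theorem LyapunovDominated.zero (T : E →L[ℂ] E) : LyapunovDominated T 0 :=
  ⟨0, ContinuousLinearMap.isPositive_zero,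
    by simp [ContinuousLinearMap.reApplyInnerSelf_apply],
    by simp [ContinuousLinearMap.reApplyInnerSelf_apply]⟩

theorem LyapunovDominated.add {T : E →L[ℂ] E} {u v : E} (hu : LyapunovDominated T u)
    (hv : LyapunovDominated T v) : LyapunovDominated T (u + v) := by
  obtain ⟨H, hH, hHT, hHu⟩ := hu
  obtain ⟨K, hK, hKT, hKv⟩ := hv
  have h2 : (0 : ℂ) ≤ ((2 : ℝ) : ℂ) := by exact_mod_cast zero_le_two
  refine ⟨((2 : ℝ) : ℂ) • (H + K), (hH.add hK).smul_of_nonneg h2, fun x => ?_, fun x => ?_⟩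
  · simp only [reApplyInnerSelf_real_smul, reApplyInnerSelf_add]
    linarith [hHT x, hKT x]
  · simp only [reApplyInnerSelf_real_smul, reApplyInnerSelf_add, inner_add_left]
    have h1 := pow_le_pow_left₀ (norm_nonneg _) (norm_add_le ⟪u, x⟫_ℂ ⟪v, x⟫_ℂ) 2
    nlinarith [hHu x, hKv x, sq_nonneg (‖⟪u, x⟫_ℂ‖ - ‖⟪v, x⟫_ℂ‖)]

variable [CompleteSpace E]

/-- A Lyapunov function for `T` which strictly decreases along a functional generated by a
generalized eigenvector of the adjoint, for an eigenvalue of modulus less than one. -/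
theorem exists_isPositive_strict_decrease (T : E →L[ℂ] E) {μ : ℂ} (hμ : ‖μ‖ < 1) (k : ℕ) (u : E)
    (hu : (((T.adjoint : E →ₗ[ℂ] E) - μ • (1 : Module.End ℂ E)) ^ k) u = 0) :
    ∃ H : E →L[ℂ] E, H.IsPositive ∧
      ∀ x, H.reApplyInnerSelf (T x) + ‖⟪u, x⟫_ℂ‖ ^ 2 ≤ H.reApplyInnerSelf x := by
  induction k generalizing u with
  | zero =>
    have : u = 0 := by simpa using hu
    exact ⟨0, ContinuousLinearMap.isPositive_zero, fun x => by
      simp [this, ContinuousLinearMap.reApplyInnerSelf_apply]⟩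
  | succ k ih =>
    set v := T.adjoint u - μ • u with hv
    obtain ⟨H, hH, hdec⟩ := ih v (by simpa [pow_succ, hv] using hu)
    have hδ : 0 < 1 - ‖μ‖ := by linarith
    set d : ℝ := (1 - ‖μ‖)⁻¹ with hd
    have hd0 : 0 < d := inv_pos.mpr hδ
    have hdδ : d * (1 - ‖μ‖) = 1 := inv_mul_cancel₀ hδ.ne'
    refine ⟨(d : ℂ) • (InnerProductSpace.rankOne ℂ u u + (d : ℂ) • H), ?_, fun x => ?_⟩
    · have hdc : (0 : ℂ) ≤ (d : ℂ) := by exact_mod_cast hd0.le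
      refine ContinuousLinearMap.IsPositive.smul_of_nonneg (.add ?_ (hH.smul_of_nonneg hdc)) hdc
      exact InnerProductSpace.isPositive_rankOne_self u
    · simp only [reApplyInnerSelf_real_smul, reApplyInnerSelf_add, reApplyInnerSelf_rankOne_self]
      have h1 : ⟪u, T x⟫_ℂ = starRingEnd ℂ μ * ⟪u, x⟫_ℂ + ⟪v, x⟫_ℂ := by
        rw [← ContinuousLinearMap.adjoint_inner_left, hv, inner_sub_left, inner_smul_left]
        ring
      have h2 := norm_mul_add_sq_le (μ := starRingEnd ℂ μ) (by simpa using hμ)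
        ⟪u, x⟫_ℂ ⟪v, x⟫_ℂ
      rw [← h1, RCLike.norm_conj, ← hd] at h2
      have h3 := mul_le_mul_of_nonneg_left (hdec x) hd0.le
      have h4 : d * (‖⟪u, T x⟫_ℂ‖ ^ 2 + d * H.reApplyInnerSelf (T x))
          ≤ d * (‖μ‖ * ‖⟪u, x⟫_ℂ‖ ^ 2 + d * H.reApplyInnerSelf x) :=
        mul_le_mul_of_nonneg_left (by linarith) hd0.le
      linear_combination h4 - ‖⟪u, x⟫_ℂ‖ ^ 2 * hdδ

theorem LyapunovDominated.of_mem_maxGenEigenspace {T : E →L[ℂ] E} {M : ℝ}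
    (hT : ∀ n : ℕ, ‖T ^ n‖ ≤ M) {μ : ℂ} {u : E}
    (hu : u ∈ Module.End.maxGenEigenspace (T.adjoint : E →ₗ[ℂ] E) μ) : LyapunovDominated T u := by
  obtain ⟨k, hk⟩ := (Module.End.mem_maxGenEigenspace _ _ _).mp hu
  have hL : ∀ u, ∃ C : ℝ, ∀ n : ℕ, ‖((T.adjoint : E →ₗ[ℂ] E) ^ n) u‖ ≤ C := by
    refine fun u => ⟨M * ‖u‖, fun n => ?_⟩
    have h1 : ((T.adjoint : E →ₗ[ℂ] E) ^ n) u = (star (T ^ n)) u := by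
      rw [star_pow, ContinuousLinearMap.star_eq_adjoint, ← ContinuousLinearMap.toLinearMap_pow]
      rfl
    rw [h1]
    exact (star (T ^ n)).le_of_opNorm_le (by rw [norm_star]; exact hT n) u
  rcases lt_or_ge ‖μ‖ 1 with hμ | hμ
  · obtain ⟨H, hH, hdec⟩ := exists_isPositive_strict_decrease T hμ k u hk
    refine ⟨H, hH, fun x => ?_, fun x => ?_⟩
    · linarith [hdec x, sq_nonneg ‖⟪u, x⟫_ℂ‖]
    · linarith [hdec x, hH.2 (T x)]
  · have hev := map_eq_smul_of_bounded_orbits _ hL hμ k u hk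
    rcases eq_or_ne u 0 with rfl | hu0
    · exact .zero T
    obtain ⟨C, hC⟩ := hL u
    have hμ1 := norm_le_one_of_bounded_orbit_of_eigenvector _ hu0 hev hC
    refine ⟨InnerProductSpace.rankOne ℂ u u, InnerProductSpace.isPositive_rankOne_self u,
      fun x => ?_, fun x => ?_⟩
    · rw [reApplyInnerSelf_rankOne_self, reApplyInnerSelf_rankOne_self,
        ← ContinuousLinearMap.adjoint_inner_left]
      rw [ContinuousLinearMap.coe_coe] at hev
      rw [hev, inner_smul_left, norm_mul, RCLike.norm_conj]
      gcongr
      exact mul_le_of_le_one_left (norm_nonneg _) hμ1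
    · rw [reApplyInnerSelf_rankOne_self]

variable [FiniteDimensional ℂ E]

theorem LyapunovDominated.of_powerBounded {T : E →L[ℂ] E} {M : ℝ}
    (hT : ∀ n : ℕ, ‖T ^ n‖ ≤ M) (u : E) : LyapunovDominated T u := by
  have hu : u ∈ ⨆ μ, Module.End.maxGenEigenspace (T.adjoint : E →ₗ[ℂ] E) μ := by
    rw [Module.End.iSup_maxGenEigenspace_eq_top]
    trivial
  induction hu using Submodule.iSup_induction' with
  | mem μ x hx => exact .of_mem_maxGenEigenspace hT hx
  | zero => exact .zero T
  | add x y _ _ hx hy => exact hx.add hy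

/-- A power bounded operator on a finite-dimensional Hilbert space is similar to a contraction. -/
theorem exists_unit_norm_conj_le_one {T : E →L[ℂ] E} {M : ℝ} (hT : ∀ n : ℕ, ‖T ^ n‖ ≤ M) :
    ∃ S : (E →L[ℂ] E)ˣ, ‖(S : E →L[ℂ] E) * T * (↑S⁻¹ : E →L[ℂ] E)‖ ≤ 1 := by
  let b := stdOrthonormalBasis ℂ E
  choose H hH hHT hHb using fun i => LyapunovDominated.of_powerBounded hT (b i)
  have hpos : (∑ i, H i).IsPositive := ContinuousLinearMap.isPositive_sum _ fun i _ => hH i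
  obtain ⟨S, hS⟩ := CStarAlgebra.nonneg_iff_eq_star_mul_self.mp
    ((ContinuousLinearMap.nonneg_iff_isPositive _).mpr hpos)
  have hSx (x : E) : ∑ i, (H i).reApplyInnerSelf x = ‖S x‖ ^ 2 := by
    rw [← reApplyInnerSelf_sum, hS, ContinuousLinearMap.reApplyInnerSelf_apply,
      ContinuousLinearMap.star_eq_adjoint, mul_apply_eq_comp,
      ContinuousLinearMap.adjoint_inner_left, inner_self_eq_norm_sq]
  have hST (x : E) : ‖S (T x)‖ ≤ ‖S x‖ := by
    refine le_of_sq_le_sq ?_ (norm_nonneg _)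
    rw [← hSx, ← hSx]
    exact Finset.sum_le_sum fun i _ => hHT i x
  have hinj : Function.Injective S := by
    refine (injective_iff_map_eq_zero S).mpr fun x hx => ?_
    have h1 : ‖x‖ ^ 2 ≤ ‖S x‖ ^ 2 := by
      rw [← hSx, ← b.sum_sq_norm_inner_right x]
      exact Finset.sum_le_sum fun i _ => hHb i x
    simpa [hx] using h1
  have hunit : IsUnit S := ContinuousLinearMap.isUnit_iff_bijective.mpr
    ⟨hinj, (LinearMap.injective_iff_surjective (f := (S : E →ₗ[ℂ] E))).mp hinj⟩
  obtain ⟨S, rfl⟩ := hunit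
  refine ⟨S, ContinuousLinearMap.opNorm_le_bound _ zero_le_one fun y => ?_⟩
  have h1 : (S : E →L[ℂ] E) ((↑S⁻¹ : E →L[ℂ] E) y) = y := by
    rw [← mul_apply_eq_comp, Units.mul_inv, one_apply_eq_self]
  have h2 := hST ((↑S⁻¹ : E →L[ℂ] E) y)
  rw [h1] at h2
  simpa using h2

end PowerBounded


/-- If `A ∈ M_m(ℂ)` has spectral radius `1` and `‖Aⁿ‖ ≤ M` (operator norm) for all `n`, then
there is an invertible `P` with `‖P A P⁻¹‖ = 1`. -/
theorem stmt8 {m : ℕ} (A : Matrix (Fin m) (Fin m) ℂ)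
    (hr : spectralRadius ℂ (Matrix.toEuclideanCLM (𝕜 := ℂ) A) = 1)
    (M : ℝ) (hM : 0 < M)
    (hb : ∀ n : ℕ, ‖Matrix.toEuclideanCLM (𝕜 := ℂ) (A ^ n)‖ ≤ M) :
    ∃ P : Matrix (Fin m) (Fin m) ℂ, IsUnit P ∧
      ‖Matrix.toEuclideanCLM (𝕜 := ℂ) (P * A * P⁻¹)‖ = 1 := by
  let φ := Matrix.toEuclideanCLM (n := Fin m) (𝕜 := ℂ)
  obtain ⟨S, hS⟩ := exists_unit_norm_conj_le_one (T := φ A) (M := M) fun n => by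
    rw [← map_pow]
    exact hb n
  have hnontriv : Nontrivial (EuclideanSpace ℂ (Fin m) →L[ℂ] EuclideanSpace ℂ (Fin m)) := by
    by_contra h
    rw [not_nontrivial_iff_subsingleton] at h
    simp [Subsingleton.elim (Matrix.toEuclideanCLM (𝕜 := ℂ) A) 0] at hr
  let P : (Matrix (Fin m) (Fin m) ℂ)ˣ := Units.map (φ.symm : _ →* _) S
  have hP : φ (P * A * (P : Matrix (Fin m) (Fin m) ℂ)⁻¹) = S * φ A * ↑S⁻¹ := by
    rw [← Matrix.coe_units_inv, map_mul, map_mul]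
    simp [P, ← map_inv]
  refine ⟨P, P.isUnit, ?_⟩
  change ‖φ (P * A * (P : Matrix (Fin m) (Fin m) ℂ)⁻¹)‖ = 1
  rw [hP]
  refine le_antisymm hS ?_
  have h1 := spectrum.spectralRadius_le_nnnorm (𝕜 := ℂ) (S * φ A * ↑S⁻¹)
  rw [spectralRadius, spectrum.units_conjugate] at h1
  have h2 := hr.symm.trans_le h1
  exact_mod_cast h2
end

section
/- Let A be a finite dimensional C*-algebra and a ∈ A with r = r(a) > 0. Then the sequence (aⁿ/rⁿ) is bounded in norm if and only if there exists an invertible b ∈ A similar to a (b = p a p⁻¹ for some invertible p ∈ A) with ‖b‖ = r. -/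
open Filter Topology

section FixedPoint

/-- A continuous linear map has a fixed point in every compact convex set that contains one of its
forward orbits. -/
theorem exists_mem_fixed_of_orbit_mem {E : Type*} [NormedAddCommGroup E] [NormedSpace ℝ E]
    (T : E →L[ℝ] E) {s : Set E} (hs : IsCompact s) (hconv : Convex ℝ s) {x : E}
    (hx : ∀ n : ℕ, T^[n] x ∈ s) : ∃ y ∈ s, T y = y := by
  set u : ℕ → E := fun n ↦ birkhoffAverage ℝ T id (n + 1) x with hu
  have hmem : ∀ n, u n ∈ s := fun n ↦ by
    simp only [hu, birkhoffAverage, birkhoffSum, Finset.smul_sum]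
    refine hconv.sum_mem (fun _ _ ↦ by positivity) ?_ fun i _ ↦ hx i
    rw [Finset.sum_const, Finset.card_range, nsmul_eq_mul]
    exact mul_inv_cancel₀ (by positivity)
  have hT : ∀ n, T (u n) = birkhoffAverage ℝ T id (n + 1) (T x) := fun n ↦ by
    simp only [hu, birkhoffAverage, birkhoffSum, map_smul, map_sum, id,
      ← Function.iterate_succ_apply, ← Function.iterate_succ_apply']
  have hbdd : Bornology.IsBounded (Set.range (fun n ↦ id (T^[n] x))) :=
    hs.isBounded.subset (Set.range_subset_iff.2 hx)
  have hlim : Tendsto (fun n ↦ T (u n) - u n) atTop (𝓝 0) := by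
    simp only [hT]
    exact (tendsto_birkhoffAverage_apply_sub_birkhoffAverage ℝ hbdd).comp (tendsto_add_atTop_nat 1)
  obtain ⟨y, hy, φ, hφ, hφy⟩ := hs.tendsto_subseq hmem
  refine ⟨y, hy, sub_eq_zero.1 (tendsto_nhds_unique ?_ (hlim.comp hφ.tendsto_atTop))⟩
  exact ((T.continuous.tendsto y).comp hφy).sub hφy

end FixedPoint

section PowerBounded

/-- If the powers of `c` stay in a compact set, then some idempotent is a cluster point of them. -/
theorem exists_idempotent_mapClusterPt_pow {R : Type*} [Monoid R] [TopologicalSpace R] [T2Space R]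
    [ContinuousMul R] {s : Set R} (hs : IsCompact s) {c : R} (hc : ∀ n : ℕ, c ^ n ∈ s) :
    ∃ e : R, e * e = e ∧ Commute c e ∧ MapClusterPt e atTop fun n : ℕ ↦ c ^ n := by
  set S : Set R := {x | MapClusterPt x atTop fun n : ℕ ↦ c ^ n} with hS
  have hSs : S ⊆ s := fun x hx ↦
    hs.isClosed.mem_of_mapClusterPt hx (Eventually.of_forall hc)
  have hScomp : IsCompact S := hs.of_isClosed_subset isClosed_setOfPred_clusterPt hSs
  have hSne : S.Nonempty := by
    obtain ⟨x, -, hx⟩ := hs.exists_mapClusterPt (f := atTop) (u := fun n : ℕ ↦ c ^ n)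
      (tendsto_principal.2 (Eventually.of_forall hc))
    exact ⟨x, hx⟩
  obtain ⟨e, he, hee⟩ := exists_idempotent_in_compact_subsemigroup
    (fun r ↦ continuous_mul_const r) S hSne hScomp fun x hx y hy ↦ by
      have h : MapClusterPt (x * y) (atTop ×ˢ atTop)
          ((fun p : R × R ↦ p.1 * p.2) ∘ Prod.map (fun n : ℕ ↦ c ^ n) fun n : ℕ ↦ c ^ n) :=
        (MapClusterPt.prodMap hx hy).continuousAt_comp (f := fun p : R × R ↦ p.1 * p.2)
          continuous_mul.continuousAt
      refine MapClusterPt.of_comp (φ := fun p : ℕ × ℕ ↦ p.1 + p.2) (p := atTop ×ˢ atTop)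
        (tendsto_atTop_mono (fun p ↦ Nat.le_add_right p.1 p.2) tendsto_fst) ?_
      convert h using 1
      ext p
      simp [pow_add]
  refine ⟨e, hee, ?_, he⟩
  have hcl : IsClosed {x : R | c * x = x * c} :=
    isClosed_eq (continuous_const_mul c) (continuous_mul_const c)
  exact hcl.mem_of_mapClusterPt he (Eventually.of_forall fun n ↦ (Commute.self_pow c n).eq)

end PowerBounded

section CStarOrder

variable {A : Type*} [CStarAlgebra A] [PartialOrder A] [StarOrderedRing A]

theorem star_add_mul_add_le (x y : A) :
    star (x + y) * (x + y) ≤ (2 : ℝ) • (star x * x + star y * y) := by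
  rw [← sub_nonneg]
  convert star_mul_self_nonneg (x - y) using 1
  rw [two_smul, star_add, star_sub]
  noncomm_ring

theorem star_mul_mul_le_smul (g f : A) {k : ℝ} (hg : ‖g‖ ≤ k) :
    star (g * f) * (g * f) ≤ k ^ 2 • (star f * f) := by
  have h1 : star g * g ≤ algebraMap ℝ A (k ^ 2) :=
    CStarAlgebra.star_mul_le_algebraMap_norm_sq.trans <|
      algebraMap_mono A (pow_le_pow_left₀ (norm_nonneg g) hg 2)
  have h2 := star_left_conjugate_le_conjugate h1 f
  rw [Algebra.algebraMap_eq_smul_one, mul_smul_comm, mul_one, smul_mul_assoc] at h2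
  rwa [star_mul, mul_assoc, ← mul_assoc (star g), ← mul_assoc]

/-- A solution `h` of the Stein inequality `c⋆ h c ≤ h` that is bounded below makes `c` similar to
a contraction. -/
theorem exists_units_norm_conj_le_one_of_star_mul_mul_le {c h : A} {δ : ℝ} (hδ : 0 < δ)
    (hδh : δ • (1 : A) ≤ h) (hc : star c * h * c ≤ h) :
    ∃ p : Aˣ, ‖(p : A) * c * (↑p⁻¹ : A)‖ ≤ 1 := by
  have h0 : 0 ≤ h := (smul_nonneg hδ.le zero_le_one).trans hδh
  have hunit : IsUnit h := CStarAlgebra.isUnit_of_le (δ • (1 : A)) hδh <|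
    ⟨smul_nonneg hδ.le zero_le_one, by
      rw [← Algebra.algebraMap_eq_smul_one]; exact hδ.ne'.isUnit.map (algebraMap ℝ A)⟩
  obtain ⟨p, hp⟩ := (CFC.isUnit_sqrt_iff h h0).2 hunit
  have hpp : star (p : A) * p = h := by
    have hsa : IsSelfAdjoint (p : A) := hp ▸ (CFC.sqrt_nonneg h).isSelfAdjoint
    rw [hsa.star_eq, hp, CFC.sqrt_mul_sqrt_self h h0]
  refine ⟨p, ?_⟩
  set q : A := (↑p⁻¹ : A)
  have hpq : (p : A) * q = 1 := p.mul_inv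
  have key : star ((p : A) * c * q) * ((p : A) * c * q) ≤ 1 :=
    calc star ((p : A) * c * q) * ((p : A) * c * q) = star q * (star c * h * c) * q := by
          rw [← hpp]; simp only [star_mul, mul_assoc]
      _ ≤ star q * h * q := star_left_conjugate_le_conjugate hc q
      _ = star ((p : A) * q) * ((p : A) * q) := by rw [← hpp]; simp only [star_mul, mul_assoc]
      _ = 1 := by rw [hpq, star_one, one_mul]
  have := (CStarAlgebra.norm_le_one_iff_of_nonneg _ (star_mul_self_nonneg _)).2 key
  rw [CStarRing.norm_star_mul_self] at this
  nlinarith [norm_nonneg ((p : A) * c * q)]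

/-- On the range of an idempotent cluster point of its powers, a power bounded element preserves a
quadratic form that is bounded below. -/
theorem exists_invariant_form_of_mapClusterPt [ProperSpace A] {c e : A} {M : ℝ} (hM : 0 < M)
    (hc : ∀ n : ℕ, ‖c ^ n‖ ≤ M) (hee : e * e = e) (hce : Commute c e)
    (he : MapClusterPt e atTop fun n : ℕ ↦ c ^ n) :
    ∃ h : A, (4 * M ^ 2)⁻¹ • (star e * e) ≤ h ∧ star c * h * c = h := by
  let T : A →L[ℝ] A := ContinuousLinearMap.mulLeftRight ℝ A (star c) c
  have hT : ∀ x, T x = star c * x * c := fun x ↦ rfl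
  have horbit : ∀ n : ℕ, T^[n] (star e * e) = star (c ^ n * e) * (c ^ n * e) := fun n ↦ by
    induction n with
    | zero => simp
    | succ n ih =>
      have hcomm : c ^ n * e * c = c ^ (n + 1) * e := by
        rw [mul_assoc, ← hce.eq, ← mul_assoc, pow_succ]
      rw [Function.iterate_succ_apply', ih, hT, ← hcomm]
      simp only [star_mul, mul_assoc]
  have hlower : ∀ n : ℕ, (4 * M ^ 2)⁻¹ • (star e * e) ≤ star (c ^ n * e) * (c ^ n * e) :=
    fun n ↦ by
    obtain ⟨k, hk, hnk⟩ := ((he.frequently (Metric.closedBall_mem_nhds e one_half_pos)).and_eventually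
      (eventually_ge_atTop n)).exists
    have hk' : ‖e - c ^ k‖ ≤ 1 / 2 := by
      rw [← dist_eq_norm, dist_comm]; exact hk
    have hsplit : e = (e - c ^ k) * e + c ^ (k - n) * (c ^ n * e) := by
      rw [← mul_assoc, ← pow_add, Nat.sub_add_cancel hnk, sub_mul, hee, sub_add_cancel]
    have h1 := star_add_mul_add_le ((e - c ^ k) * e) (c ^ (k - n) * (c ^ n * e))
    rw [← hsplit] at h1
    have h2 := h1.trans (smul_le_smul_of_nonneg_left (add_le_add
      (star_mul_mul_le_smul (e - c ^ k) e hk')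
      (star_mul_mul_le_smul (c ^ (k - n)) (c ^ n * e) (hc _))) zero_le_two)
    have h3 : (1 / 2 : ℝ) • (star e * e) ≤
        (2 * M ^ 2) • (star (c ^ n * e) * (c ^ n * e)) := by
      rw [← sub_nonneg] at h2 ⊢
      convert h2 using 1
      module
    have h4 := smul_le_smul_of_nonneg_left h3 (show 0 ≤ (2 * M ^ 2)⁻¹ by positivity)
    rw [smul_smul, smul_smul, inv_mul_cancel₀ (by positivity), one_smul] at h4
    convert h4 using 2
    field_simp
    norm_num
  obtain ⟨h, hmem, hfix⟩ := exists_mem_fixed_of_orbit_mem T (x := star e * e)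
    ((isCompact_closedBall (0 : A) ((M * ‖e‖) * (M * ‖e‖))).inter_right
      (isClosed_Ici (a := (4 * M ^ 2)⁻¹ • (star e * e))))
    ((convex_closedBall _ _).inter (convex_Ici _)) fun n ↦ by
      rw [horbit]
      refine ⟨?_, hlower n⟩
      have hn : ‖c ^ n * e‖ ≤ M * ‖e‖ :=
        (norm_mul_le _ _).trans (mul_le_mul_of_nonneg_right (hc n) (norm_nonneg e))
      rw [mem_closedBall_zero_iff, CStarRing.norm_star_mul_self]
      exact mul_self_le_mul_self (norm_nonneg _) hn
  exact ⟨h, hmem.2, hfix⟩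

/-- On the kernel of an idempotent cluster point of its powers, an element contracts a quadratic
form that is bounded below. -/
theorem exists_contracted_form_of_mapClusterPt {c e : A} (hee : e * e = e) (hce : Commute c e)
    (he : MapClusterPt e atTop fun n : ℕ ↦ c ^ n) :
    ∃ h : A, star (1 - e) * (1 - e) ≤ h ∧ star c * h * c ≤ h := by
  have hf : (1 - e) * (1 - e) = 1 - e := IsIdempotentElem.one_sub hee
  have hcf : Commute c (1 - e) := (Commute.one_right c).sub_right hce
  have hlim : Tendsto (fun x : A ↦ ‖(1 - e) * x‖) (𝓝 e) (𝓝 ‖(1 - e) * e‖) :=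
    Continuous.tendsto (by fun_prop) e
  rw [sub_mul, one_mul, hee, sub_self, norm_zero] at hlim
  obtain ⟨m, hm, hm1⟩ := ((he.frequently (hlim.eventually_le_const one_pos)).and_eventually
    (eventually_ge_atTop 1)).exists
  set f : A := 1 - e
  set d : ℕ → A := fun n ↦ star (c ^ n * f) * (c ^ n * f) with hd
  have hstep : ∀ n, star c * d n * c = d (n + 1) := fun n ↦ by
    have hcomm : c ^ n * f * c = c ^ (n + 1) * f := by
      rw [mul_assoc, ← hcf.eq, ← mul_assoc, pow_succ]
    simp only [hd]
    rw [← hcomm]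
    simp only [star_mul, mul_assoc]
  have hd0 : d 0 = star f * f := by simp [hd]
  have hdm : d m ≤ d 0 := by
    have hfm : c ^ m * f = f * c ^ m * f := by
      rw [← (hcf.pow_left m).eq, mul_assoc, hf]
    have := star_mul_mul_le_smul (f * c ^ m) f hm
    rw [← hfm, one_pow, one_smul] at this
    rwa [hd0]
  refine ⟨∑ n ∈ Finset.range m, d n, ?_, ?_⟩
  · rw [← hd0]
    exact Finset.single_le_sum (f := d) (fun n _ ↦ star_mul_self_nonneg _) (Finset.mem_range.2 hm1)
  · rw [Finset.mul_sum, Finset.sum_mul, ← sub_nonpos]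
    simp only [hstep]
    rw [← Finset.sum_sub_distrib, Finset.sum_range_sub]
    exact sub_nonpos.2 hdm

end CStarOrder

/-- A power bounded element of a C⋆-algebra whose closed balls are compact is similar to a
contraction. -/
theorem exists_units_norm_conj_le_one_of_norm_pow_le {A : Type*} [CStarAlgebra A] [ProperSpace A]
    {c : A} {M : ℝ} (hc : ∀ n : ℕ, ‖c ^ n‖ ≤ M) :
    ∃ p : Aˣ, ‖(p : A) * c * (↑p⁻¹ : A)‖ ≤ 1 := by
  let _ := CStarAlgebra.spectralOrder A
  have _ := CStarAlgebra.spectralOrderedRing A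
  wlog hM : 0 < M generalizing M
  · exact this (M := 1) (fun n ↦ (hc n).trans (by linarith)) one_pos
  obtain ⟨e, hee, hce, he⟩ := exists_idempotent_mapClusterPt_pow (isCompact_closedBall (0 : A) M)
    (c := c) fun n ↦ mem_closedBall_zero_iff.2 (hc n)
  obtain ⟨h₁, hlow₁, hc₁⟩ := exists_invariant_form_of_mapClusterPt hM hc hee hce he
  obtain ⟨h₂, hlow₂, hc₂⟩ := exists_contracted_form_of_mapClusterPt hee hce he
  set δ : ℝ := min (4 * M ^ 2)⁻¹ 1
  have hδ : 0 < δ := lt_min (by positivity) one_pos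
  refine exists_units_norm_conj_le_one_of_star_mul_mul_le (h := h₁ + h₂) (half_pos hδ) ?_ ?_
  · have h1 : (1 : A) ≤ (2 : ℝ) • (star e * e + star (1 - e) * (1 - e)) := by
      simpa using star_add_mul_add_le e (1 - e)
    have h2 : δ • (star (1 - e) * (1 - e)) ≤ h₂ :=
      ((smul_le_smul_of_nonneg_right (min_le_right _ _) (star_mul_self_nonneg _)).trans_eq
        (one_smul ℝ _)).trans hlow₂
    have h3 : δ • (star e * e) ≤ h₁ :=
      (smul_le_smul_of_nonneg_right (min_le_left _ _) (star_mul_self_nonneg _)).trans hlow₁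
    calc (δ / 2) • (1 : A)
        ≤ (δ / 2) • (2 : ℝ) • (star e * e + star (1 - e) * (1 - e)) :=
          smul_le_smul_of_nonneg_left h1 (half_pos hδ).le
      _ = δ • (star e * e) + δ • (star (1 - e) * (1 - e)) := by
          rw [smul_smul, div_mul_cancel₀ _ two_ne_zero, smul_add]
      _ ≤ h₁ + h₂ := add_le_add h3 h2
  · rw [mul_add, add_mul, hc₁]
    gcongr

/-- In a finite dimensional C*-algebra, for `a` with spectral radius `r > 0`, the sequence
`aⁿ/rⁿ` is bounded iff `a` is similar (via an invertible element of the algebra) to an element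
of norm `r`. -/
theorem stmt10 {A : Type*} [CStarAlgebra A] [FiniteDimensional ℂ A]
    (a : A) (r : ℝ) (hr0 : 0 < r)
    (hr : spectralRadius ℂ a = ENNReal.ofReal r) :
    (∃ M : ℝ, ∀ n : ℕ, ‖a ^ n‖ ≤ M * r ^ n) ↔
      ∃ p : Aˣ, ‖(↑p : A) * a * (↑p⁻¹ : A)‖ = r := by
  have : ProperSpace A := FiniteDimensional.proper ℂ A
  have : Nontrivial A := by
    by_contra h
    rw [not_nontrivial_iff_subsingleton] at h
    rw [spectrum.SpectralRadius.of_subsingleton] at hr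
    exact hr0.not_ge (ENNReal.ofReal_eq_zero.1 hr.symm)
  constructor
  · rintro ⟨M, hM⟩
    obtain ⟨p, hp⟩ := exists_units_norm_conj_le_one_of_norm_pow_le (c := r⁻¹ • a) (M := M)
      fun n ↦ by
        rw [smul_pow, norm_smul, norm_pow, norm_inv, Real.norm_of_nonneg hr0.le, inv_pow,
          inv_mul_le_iff₀ (by positivity), mul_comm]
        exact hM n
    refine ⟨p, le_antisymm ?_ ?_⟩
    · rwa [mul_smul_comm, smul_mul_assoc, norm_smul, norm_inv, Real.norm_of_nonneg hr0.le,
        inv_mul_le_iff₀ hr0, mul_one] at hp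
    · have h := spectrum.spectralRadius_le_nnnorm (𝕜 := ℂ) ((p : A) * a * (↑p⁻¹ : A))
      rw [spectralRadius, spectrum.units_conjugate, ← spectralRadius, hr] at h
      rwa [ENNReal.ofReal, ENNReal.coe_le_coe, Real.toNNReal_le_iff_le_coe, coe_nnnorm] at h
  · rintro ⟨p, hp⟩
    refine ⟨‖(↑p⁻¹ : A)‖ * ‖(p : A)‖, fun n ↦ ?_⟩
    have hconj : a ^ n = (↑p⁻¹ : A) * ((p : A) * a * (↑p⁻¹ : A)) ^ n * p := by
      rw [Units.conj_pow]
      simp [mul_assoc]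
    calc ‖a ^ n‖ ≤ ‖(↑p⁻¹ : A)‖ * ‖((p : A) * a * (↑p⁻¹ : A)) ^ n‖ * ‖(p : A)‖ :=
          hconj ▸ norm_mul₃_le
      _ ≤ ‖(↑p⁻¹ : A)‖ * r ^ n * ‖(p : A)‖ := by
          gcongr
          exact hp ▸ norm_pow_le _ n
      _ = ‖(↑p⁻¹ : A)‖ * ‖(p : A)‖ * r ^ n := by ring
end

section
/- Let φ be a nonzero positive linear map on a finite dimensional C*-algebra A. Then r(φ) is an eigenvalue of φ whose degeneracy index (size of largest Jordan block for r(φ)) equals the maximal degeneracy index d_φ = max{ d_{φ,λ} : |λ| = r(φ) }; i.e., r(φ) belongs to the maximal spectrum of φ. -/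
section

open Polynomial Filter Topology

theorem continuous_aeval_divByMonic_X_sub_C {B : Type*} [NormedRing B] [NormedAlgebra ℂ B]
    (a : B) (p : ℂ[X]) : Continuous fun z : ℂ => aeval a (p /ₘ (X - C z)) := by
  have h : ∀ z : ℂ, aeval a (p /ₘ (X - C z)) = ∑ n ∈ Finset.range (p.natDegree + 1),
      (∑ i ∈ Finset.Icc (n + 1) p.natDegree, z ^ (i - (n + 1)) * p.coeff i) • a ^ n := by
    intro z
    rw [aeval_eq_sum_range' (n := p.natDegree + 1)]
    · simp only [coeff_divByMonic_X_sub_C]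
    · rw [natDegree_divByMonic _ (monic_X_sub_C z)]
      omega
  simp only [h]
  fun_prop

theorem ringInverse_one_sub_inv_smul {B : Type*} [NormedRing B] [NormedAlgebra ℂ B] {a : B}
    {p : ℂ[X]} (hp : aeval a p = 0) {z : ℂ} (hz : z ≠ 0) (hpz : p.eval z ≠ 0) :
    Ring.inverse (1 - z⁻¹ • a) = (z / p.eval z) • aeval a (p /ₘ (X - C z)) := by
  have h1 : (X - C z) * (p /ₘ (X - C z)) = p - C (p.eval z) := by
    rw [← modByMonic_X_sub_C_eq_C_eval, eq_sub_iff_add_eq, add_comm, modByMonic_add_div]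
  have h2 : (a - algebraMap ℂ B z) * aeval a (p /ₘ (X - C z)) = - algebraMap ℂ B (p.eval z) := by
    simpa [hp] using congrArg (aeval a) h1
  have h3 : aeval a (p /ₘ (X - C z)) * (a - algebraMap ℂ B z) = - algebraMap ℂ B (p.eval z) := by
    rw [mul_comm] at h1
    simpa [hp] using congrArg (aeval a) h1
  have h4 : 1 - z⁻¹ • a = (-z⁻¹) • (a - algebraMap ℂ B z) := by
    rw [smul_sub, Algebra.algebraMap_eq_smul_one, smul_smul, neg_mul, inv_mul_cancel₀ hz]
    simp only [neg_smul, one_smul]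
    abel
  have h5 : (-z⁻¹) * (z / p.eval z) * (-p.eval z) = 1 := by field_simp
  refine Ring.inverse_unit ⟨1 - z⁻¹ • a, (z / p.eval z) • aeval a (p /ₘ (X - C z)), ?_, ?_⟩
  · rw [h4, smul_mul_smul_comm, h2, ← map_neg, Algebra.algebraMap_eq_smul_one, smul_smul, h5,
      one_smul]
  · rw [h4, smul_mul_smul_comm, h3, ← map_neg, Algebra.algebraMap_eq_smul_one, smul_smul,
      mul_comm (z / _), h5, one_smul]

theorem exists_tendsto_pow_rootMultiplicity_smul_inverse {B : Type*} [NormedRing B]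
    [NormedAlgebra ℂ B] [Nontrivial B] {a : B} (ha : IsIntegral ℂ a) {μ : ℂ} (hμ : μ ≠ 0) :
    ∃ L : B, L ≠ 0 ∧ Tendsto
      (fun z : ℂ => (z - μ) ^ (minpoly ℂ a).rootMultiplicity μ • Ring.inverse (1 - z⁻¹ • a))
      (𝓝[≠] μ) (𝓝 L) := by
  set p := minpoly ℂ a with hp
  have hp0 : p ≠ 0 := minpoly.ne_zero ha
  set m := p.rootMultiplicity μ
  set q := p /ₘ (X - C μ) ^ m
  have hpq : (X - C μ) ^ m * q = p := pow_mul_divByMonic_rootMultiplicity_eq p μ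
  have hq : q.eval μ ≠ 0 := eval_divByMonic_pow_rootMultiplicity_ne_zero μ hp0
  refine ⟨(μ / q.eval μ) • aeval a (p /ₘ (X - C μ)), smul_ne_zero (div_ne_zero hμ hq) ?_, ?_⟩
  · have hdeg : 0 < p.natDegree := minpoly.natDegree_pos ha
    have hd : (p /ₘ (X - C μ)).natDegree = p.natDegree - 1 := by
      rw [natDegree_divByMonic _ (monic_X_sub_C μ), natDegree_X_sub_C]
    intro h0
    have hne : p /ₘ (X - C μ) ≠ 0 := by
      rw [Ne, divByMonic_eq_zero_iff (monic_X_sub_C μ), degree_X_sub_C, not_lt]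
      exact natDegree_pos_iff_degree_pos.mp hdeg |> Nat.WithBot.one_le_iff_zero_lt.mpr
    have := natDegree_le_natDegree (minpoly.degree_le_of_ne_zero ℂ a hne h0)
    rw [← hp] at this
    omega
  · have hlim : Tendsto (fun z : ℂ => (z / q.eval z) • aeval a (p /ₘ (X - C z))) (𝓝[≠] μ)
        (𝓝 ((μ / q.eval μ) • aeval a (p /ₘ (X - C μ)))) := by
      refine Tendsto.mono_left ?_ nhdsWithin_le_nhds
      exact (tendsto_id.div q.continuous.continuousAt hq).smul
        (continuous_aeval_divByMonic_X_sub_C a p).continuousAt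
    refine hlim.congr' ?_
    filter_upwards [self_mem_nhdsWithin,
      nhdsWithin_le_nhds (q.continuous.continuousAt.eventually_ne hq),
      nhdsWithin_le_nhds (eventually_ne_nhds hμ)] with z hz hqz hz0
    have hzμ : z - μ ≠ 0 := sub_ne_zero.mpr hz
    have hpz : p.eval z = (z - μ) ^ m * q.eval z := by simp [← hpq]
    rw [ringInverse_one_sub_inv_smul (minpoly.aeval ℂ a) hz0
      (by rw [← hp, hpz]; exact mul_ne_zero (pow_ne_zero _ hzμ) hqz), ← hp, hpz, smul_smul]
    congr 1
    field_simp

theorem hasSum_inverse_one_sub_inv_smul {B : Type*} [NormedRing B] [NormedAlgebra ℂ B]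
    [CompleteSpace B] {a : B} {z : ℂ} (hz : spectralRadius ℂ a < ‖z‖₊) :
    HasSum (fun n : ℕ => z⁻¹ ^ n • a ^ n) (Ring.inverse (1 - z⁻¹ • a)) := by
  have hz0 : z ≠ 0 := by rintro rfl; simp at hz
  have hz' : (‖z⁻¹‖₊ : ENNReal) < (spectralRadius ℂ a)⁻¹ := by
    rw [nnnorm_inv, ENNReal.coe_inv (by simpa using hz0)]
    exact ENNReal.inv_lt_inv.mpr hz
  obtain ⟨s, hs1, hs2⟩ := ENNReal.lt_iff_exists_nnreal_btwn.mp hz'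
  have hs0 : 0 < s := ENNReal.coe_pos.mp hs1.bot_lt
  have h1 := (spectrum.differentiableOn_inverse_one_sub_smul hs2).hasFPowerSeriesOnBall hs0
  have h2 := (spectrum.hasFPowerSeriesOnBall_inverse_one_sub_smul ℂ a).exchange_radius h1
  have h3 := h2.hasSum (y := z⁻¹) (by rwa [Metric.mem_eball, edist_zero_right, enorm_eq_nnnorm])
  simpa using h3

section

variable {A : Type*} [CStarAlgebra A] [PartialOrder A] [StarOrderedRing A]

theorem norm_le_of_neg_le_of_le {a b : A} (ha : IsSelfAdjoint a) (h1 : -b ≤ a) (h2 : a ≤ b) :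
    ‖a‖ ≤ ‖b‖ := by
  have hb : IsSelfAdjoint b := by
    have h : IsSelfAdjoint (b - a) := .of_nonneg (sub_nonneg.mpr h2)
    simpa using h.add ha
  nontriviality A
  have h3 := h2.trans hb.le_algebraMap_norm_self
  have h4 : -a ≤ algebraMap ℝ A ‖b‖ := (neg_le.mp h1).trans hb.le_algebraMap_norm_self
  rcases CStarAlgebra.norm_or_neg_norm_mem_spectrum ha with h | h
  · exact (le_algebraMap_iff_spectrum_le ha).mp h3 _ h
  · exact (le_algebraMap_iff_spectrum_le ha.neg).mp h4 _ (by rwa [← spectrum.neg_eq, Set.mem_neg])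

theorem norm_le_of_hasSum_smul {x : ℕ → A} (hx : ∀ n, 0 ≤ x n) {c : ℕ → ℂ} {s t : A}
    (hs : HasSum (fun n => c n • x n) s) (ht : HasSum (fun n => (‖c n‖ : ℂ) • x n) t) :
    ‖s‖ ≤ 2 * ‖t‖ := by
  have key : ∀ {c' : ℕ → ℝ} {u : A}, (∀ n, |c' n| ≤ ‖c n‖) → HasSum (fun n => (c' n : ℂ) • x n) u →
      ‖u‖ ≤ ‖t‖ := by
    intro c' u hc hu
    have hsa : IsSelfAdjoint u := by
      have h := hu.star
      simp only [star_smul, (IsSelfAdjoint.of_nonneg (hx _)).star_eq, RCLike.star_def,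
        Complex.conj_ofReal] at h
      exact h.unique hu
    refine norm_le_of_neg_le_of_le hsa (hasSum_le (fun n => ?_) ht.neg hu)
      (hasSum_le (fun n => ?_) hu ht)
    · simp only [Complex.coe_smul, ← neg_smul]
      exact smul_le_smul_of_nonneg_right (abs_le.mp (hc n)).1 (hx n)
    · simp only [Complex.coe_smul]
      exact smul_le_smul_of_nonneg_right (abs_le.mp (hc n)).2 (hx n)
  have hstar : HasSum (fun n => (starRingEnd ℂ (c n)) • x n) (star s) := by
    have h := hs.star
    simpa only [star_smul, (IsSelfAdjoint.of_nonneg (hx _)).star_eq, RCLike.star_def] using h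
  have hre : HasSum (fun n => ((c n).re : ℂ) • x n) ((2⁻¹ : ℂ) • (s + star s)) := by
    convert (hs.add hstar).const_smul (2⁻¹ : ℂ) using 2 with n
    rw [← add_smul, smul_smul, Complex.add_conj]; congr 1
    push_cast
    ring
  have him : HasSum (fun n => ((c n).im : ℂ) • x n)
      ((2⁻¹ * -Complex.I : ℂ) • (s - star s)) := by
    have h : (fun n => ((c n).im : ℂ) • x n) =
        fun n => (2⁻¹ * -Complex.I : ℂ) • (c n • x n - (starRingEnd ℂ (c n)) • x n) := by
      funext n
      rw [← sub_smul, smul_smul, Complex.sub_conj]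
      congr 1
      push_cast
      linear_combination (c n).im * Complex.I_mul_I
    rw [h]
    exact (hs.sub hstar).const_smul _
  have hdec : s = (2⁻¹ : ℂ) • (s + star s) + Complex.I • ((2⁻¹ * -Complex.I : ℂ) • (s - star s)) := by
    rw [smul_smul, show Complex.I * (2⁻¹ * -Complex.I) = 2⁻¹ by
      linear_combination (-2⁻¹ : ℂ) * Complex.I_mul_I, ← smul_add,
      add_add_sub_cancel, ← two_smul ℂ s, smul_smul]
    simp
  rw [hdec]
  refine (norm_add_le _ _).trans ?_
  rw [norm_smul Complex.I, Complex.norm_I, one_mul, two_mul]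
  exact add_le_add (key (fun n => Complex.abs_re_le_norm _) hre)
    (key (fun n => Complex.abs_im_le_norm _) him)

theorem exists_nonneg_apply_ne_zero {L : A →L[ℂ] A} (hL : L ≠ 0) : ∃ a : A, 0 ≤ a ∧ L a ≠ 0 := by
  by_contra! h
  refine hL (ContinuousLinearMap.coe_injective (LinearMap.ext_on (CStarAlgebra.span_nonneg (A := A)) ?_))
  intro a ha
  simpa using h a ha

theorem norm_inverse_apply_le {φ : A →L[ℂ] A} (hφ : ∀ a : A, 0 ≤ a → 0 ≤ φ a) {z : ℂ}
    (hz : spectralRadius ℂ φ < ‖z‖₊) {a : A} (ha : 0 ≤ a) :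
    ‖Ring.inverse (1 - z⁻¹ • φ) a‖ ≤ 2 * ‖Ring.inverse (1 - (‖z‖ : ℂ)⁻¹ • φ) a‖ := by
  have hpow : ∀ n : ℕ, 0 ≤ (φ ^ n) a := by
    intro n
    induction n with
    | zero => simpa using ha
    | succ n ih => rw [pow_succ']; exact hφ _ ih
  have h1 := hasSum_inverse_one_sub_inv_smul hz
  have h2 := hasSum_inverse_one_sub_inv_smul (a := φ) (z := (‖z‖ : ℂ)) (by simpa using hz)
  refine norm_le_of_hasSum_smul hpow (c := fun n => z⁻¹ ^ n)
    (by simpa using h1.mapL (ContinuousLinearMap.apply ℂ A a))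
    (by simpa using h2.mapL (ContinuousLinearMap.apply ℂ A a))

theorem rootMultiplicity_minpoly_le_of_positive [FiniteDimensional ℂ A] [Nontrivial A]
    {φ : A →L[ℂ] A} (hφ : ∀ a : A, 0 ≤ a → 0 ≤ φ a)
    {r : ℝ} (hr0 : 0 < r) (hr : spectralRadius ℂ φ = ENNReal.ofReal r) {lam : ℂ} (hlam : ‖lam‖ = r) :
    (minpoly ℂ φ).rootMultiplicity lam ≤ (minpoly ℂ φ).rootMultiplicity (r : ℂ) := by
  have hint : IsIntegral ℂ φ := Algebra.IsIntegral.isIntegral φ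
  have hlam0 : lam ≠ 0 := by rintro rfl; simp at hlam; linarith
  have hrC : (r : ℂ) ≠ 0 := by exact_mod_cast hr0.ne'
  obtain ⟨L, hL, hlimL⟩ := exists_tendsto_pow_rootMultiplicity_smul_inverse hint hlam0
  obtain ⟨M, -, hlimM⟩ := exists_tendsto_pow_rootMultiplicity_smul_inverse hint hrC
  obtain ⟨a, ha, hLa⟩ := exists_nonneg_apply_ne_zero hL
  set d := (minpoly ℂ φ).rootMultiplicity lam
  set m := (minpoly ℂ φ).rootMultiplicity (r : ℂ)
  by_contra! hlt
  set u : ℂ := lam / r with hu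
  have hun : ‖u‖ = 1 := by simp [hu, hlam, abs_of_pos hr0, hr0.ne']
  have hur : (r : ℂ) * u = lam := by rw [hu]; field_simp
  have hmap : ∀ v : ℂ, v ≠ 0 → Tendsto (fun t : ℝ => (t : ℂ) * v) (𝓝[>] r) (𝓝[≠] ((r : ℂ) * v)) := by
    intro v hv
    refine tendsto_nhdsWithin_iff.mpr ⟨?_, ?_⟩
    · exact ((Complex.continuous_ofReal.mul continuous_const).tendsto r).mono_left
        nhdsWithin_le_nhds
    · filter_upwards [self_mem_nhdsWithin] with t ht
      simpa [hv] using ne_of_gt (Set.mem_Ioi.mp ht)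
  have h1 := hlimL.comp (hur ▸ hmap u (by intro h; simp [h] at hun))
  have h2 := hlimM.comp (by simpa using hmap 1 one_ne_zero)
  have h1' := ((ContinuousLinearMap.apply ℂ A a).continuous.tendsto L).comp h1 |>.norm
  have h2' := ((ContinuousLinearMap.apply ℂ A a).continuous.tendsto M).comp h2 |>.norm
  have h3 : Tendsto (fun t : ℝ => 2 * (t - r) ^ (d - m)) (𝓝[>] r) (𝓝 0) := by
    have : Continuous fun t : ℝ => 2 * (t - r) ^ (d - m) := by fun_prop
    have h := (this.tendsto r).mono_left (nhdsWithin_le_nhds (s := Set.Ioi r))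
    simpa [Nat.sub_ne_zero_of_lt hlt] using h
  have h4 := h3.mul h2'
  rw [zero_mul] at h4
  have h5 := le_of_tendsto_of_tendsto h1' h4 ?_
  · exact hLa (norm_le_zero_iff.mp h5)
  · filter_upwards [self_mem_nhdsWithin] with t ht
    have ht : r < t := ht
    have htn : ‖(t : ℂ) * u‖ = t := by simp [hun, abs_of_pos (hr0.trans ht)]
    have hsub : ‖(t : ℂ) * u - lam‖ = t - r := by
      rw [← hur, ← sub_mul, norm_mul, hun, mul_one, ← Complex.ofReal_sub, Complex.norm_real,
        Real.norm_of_nonneg (by linarith)]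
    have hsub' : ‖(t : ℂ) - r‖ = t - r := by
      rw [← Complex.ofReal_sub, Complex.norm_real, Real.norm_of_nonneg (by linarith)]
    have hrad : spectralRadius ℂ φ < ‖(t : ℂ) * u‖₊ := by
      rw [hr, ← enorm_eq_nnnorm, ← ofReal_norm, htn]
      exact (ENNReal.ofReal_lt_ofReal_iff (hr0.trans ht)).mpr ht
    have hle := norm_inverse_apply_le hφ hrad ha
    rw [htn] at hle
    have hd : (t - r) ^ d = (t - r) ^ (d - m) * (t - r) ^ m := by
      rw [← pow_add, Nat.sub_add_cancel hlt.le]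
    simp only [Function.comp_apply, ContinuousLinearMap.apply_apply, _root_.smul_apply, norm_smul,
      norm_pow, hsub, hsub']
    rw [hd]
    have := mul_le_mul_of_nonneg_left hle (mul_nonneg (pow_nonneg (sub_nonneg.mpr ht.le) (d - m))
      (pow_nonneg (sub_nonneg.mpr ht.le) m))
    linarith

end

end

/-- For a nonzero positive map `φ` on a finite dimensional C*-algebra with spectral radius `r`,
`r` is an eigenvalue of `φ` whose degeneracy index (multiplicity of `(z - r)` in the minimal
polynomial, i.e. the size of the largest Jordan block) is maximal among all eigenvalues of
modulus `r`; i.e. `r` belongs to the maximal spectrum of `φ`. -/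
theorem stmt16 {A : Type*} [CStarAlgebra A] [PartialOrder A] [StarOrderedRing A]
    [FiniteDimensional ℂ A]
    (φ : A →L[ℂ] A) (hφ : ∀ a : A, 0 ≤ a → 0 ≤ φ a) (hne : φ ≠ 0)
    (r : ℝ) (hr0 : 0 ≤ r) (hr : spectralRadius ℂ φ = ENNReal.ofReal r) :
    Module.End.HasEigenvalue (φ : A →ₗ[ℂ] A) (r : ℂ) ∧
      ∀ lam : ℂ, Module.End.HasEigenvalue (φ : A →ₗ[ℂ] A) lam → ‖lam‖ = r →
        (minpoly ℂ ((φ : A →ₗ[ℂ] A) : Module.End ℂ A)).rootMultiplicity lam ≤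
          (minpoly ℂ ((φ : A →ₗ[ℂ] A) : Module.End ℂ A)).rootMultiplicity (r : ℂ) := by
  have : Nontrivial A := by
    obtain ⟨a, ha⟩ := DFunLike.ne_iff.mp hne
    exact ⟨_, _, ha⟩
  have hφe : Module.End.toContinuousLinearMap A (φ : A →ₗ[ℂ] A) = φ := rfl
  have hmin : minpoly ℂ (φ : A →ₗ[ℂ] A) = minpoly ℂ φ := by
    rw [← minpoly.algEquiv_eq (Module.End.toContinuousLinearMap A), hφe]
  have hspec : spectrum ℂ (φ : A →ₗ[ℂ] A) = spectrum ℂ φ := by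
    rw [← AlgEquiv.spectrum_eq (Module.End.toContinuousLinearMap A), hφe]
  have hle : ∀ lam : ℂ, ‖lam‖ = r → (minpoly ℂ (φ : A →ₗ[ℂ] A)).rootMultiplicity lam ≤
      (minpoly ℂ (φ : A →ₗ[ℂ] A)).rootMultiplicity (r : ℂ) := by
    intro lam hlam
    rcases hr0.eq_or_lt with h | h
    · rw [← h, norm_eq_zero] at hlam
      simp [hlam, ← h]
    · rw [hmin]
      exact rootMultiplicity_minpoly_le_of_positive hφ h hr hlam
  refine ⟨?_, fun lam _ => hle lam⟩
  obtain ⟨k, hk, hkr⟩ := spectrum.exists_nnnorm_eq_spectralRadius φ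
  have hkn : ‖k‖ = r := by
    rw [hr, ← enorm_eq_nnnorm, ← ofReal_norm] at hkr
    exact (ENNReal.ofReal_eq_ofReal_iff (norm_nonneg _) hr0).mp hkr
  have hp0 : minpoly ℂ (φ : A →ₗ[ℂ] A) ≠ 0 := minpoly.ne_zero (Algebra.IsIntegral.isIntegral _)
  rw [← hspec, ← Module.End.hasEigenvalue_iff_mem_spectrum, Module.End.hasEigenvalue_iff_isRoot,
    ← Polynomial.rootMultiplicity_pos hp0] at hk
  rw [Module.End.hasEigenvalue_iff_isRoot, ← Polynomial.rootMultiplicity_pos hp0]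
  exact hk.trans_le (hle k hkn)
end

section
/- Let τ be an irreducible completely positive map on a finite dimensional C*-algebra A with spectral radius r = r(τ) > 0. Then there exists a strictly positive L ∈ A with τ(L) = r·L, and consequently a completely positive map σ elementarily similar to τ (σ = α_v⁻¹ ∘ τ ∘ α_v for some strictly positive v) with ‖σ‖ = r. -/
open Matrix

theorem spectrum_real_finite {A : Type*} [CStarAlgebra A] [FiniteDimensional ℂ A] (a : A) :
    (spectrum ℝ a).Finite := by
  have : FiniteDimensional ℝ A := FiniteDimensional.trans ℝ ℂ A
  refine (Polynomial.finite_setOfPred_isRoot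
    (minpoly.ne_zero (Algebra.IsIntegral.isIntegral (R := ℝ) a))).subset fun x hx ↦ ?_
  have h := spectrum.subset_polynomial_aeval a (minpoly ℝ a) ⟨x, hx, rfl⟩
  rw [minpoly.aeval] at h
  rcases subsingleton_or_nontrivial A with hA | hA
  · simp at h
  · simpa using h

/-- The property that all amplifications of `σ` send matrices `Bᴴ * B` to matrices `Cᴴ * C`. -/
def PreservesGram {A : Type*} [CStarAlgebra A] (σ : A →L[ℂ] A) : Prop :=
  ∀ (k : ℕ) (B : Matrix (Fin k) (Fin k) A),
    ∃ C : Matrix (Fin k) (Fin k) A, (Bᴴ * B).map σ = Cᴴ * C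

theorem PreservesGram.conj {A : Type*} [CStarAlgebra A] {τ : A →L[ℂ] A}
    (h : PreservesGram τ) (u v : A) :
    PreservesGram ((ContinuousLinearMap.mulLeftRight ℂ A (star u) u).comp
        (τ.comp (ContinuousLinearMap.mulLeftRight ℂ A (star v) v))) := by
  intro k B
  obtain ⟨C, hC⟩ := h k (B * diagonal fun _ ↦ v)
  refine ⟨C * diagonal fun _ ↦ u, ?_⟩
  ext i j
  have h1 := congr($hC i j)
  have hstar (M : Matrix (Fin k) (Fin k) A) (a : A) :
      ((M * diagonal fun _ ↦ a)ᴴ * (M * diagonal fun _ ↦ a) : Matrix _ _ A) i j =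
        star a * (Mᴴ * M) i j * a := by
    rw [conjTranspose_mul, diagonal_conjTranspose, ← Matrix.mul_assoc, Matrix.mul_diagonal,
      Matrix.mul_assoc, Matrix.diagonal_mul]
    rfl
  rw [map_apply, hstar] at h1
  rw [hstar, ← h1]
  rfl

section PositiveMaps

variable {A : Type*} [CStarAlgebra A] [PartialOrder A] [StarOrderedRing A]

/-- The support projection of a positive element of a finite dimensional C⋆-algebra. -/
theorem exists_support_projection [FiniteDimensional ℂ A] {w : A} (hw : 0 ≤ w) :
    ∃ e w' : A, IsStarProjection e ∧ e * w = w ∧ w * e = w ∧ w * w' = e ∧ w' * w = e ∧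
      ∃ c : ℝ, 0 ≤ c ∧ e ≤ c • w := by
  have hsa : IsSelfAdjoint w := .of_nonneg hw
  have hfin := spectrum_real_finite w
  have hc (f : ℝ → ℝ) : ContinuousOn f (spectrum ℝ w) := hfin.continuousOn f
  have hid : cfc (fun x : ℝ ↦ x) w = w := cfc_id' ℝ w
  have hmul (f g : ℝ → ℝ) : cfc f w * cfc g w = cfc (fun x ↦ f x * g x) w :=
    (cfc_mul f g w (hc f) (hc g)).symm
  refine ⟨cfc (fun x : ℝ ↦ x * x⁻¹) w, cfc (fun x : ℝ ↦ x⁻¹) w, ⟨?_, ?_⟩, ?_, ?_, ?_, ?_,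
    ‖cfc (fun x : ℝ ↦ x⁻¹) w‖, norm_nonneg _, ?_⟩
  · rw [IsIdempotentElem, hmul]
    congr 1 with x
    by_cases hx : x = 0 <;> simp [hx]
  · exact cfc_predicate _ w
  · have := hmul (fun x ↦ x * x⁻¹) (fun x ↦ x)
    simpa only [hid, mul_inv_mul_cancel] using this
  · have := hmul (fun x ↦ x) (fun x ↦ x * x⁻¹)
    simpa only [hid, ← mul_assoc, mul_self_mul_inv] using this
  · simpa only [hid] using hmul (fun x ↦ x) (fun x ↦ x⁻¹)
  · simpa only [hid, mul_comm] using hmul (fun x ↦ x⁻¹) (fun x ↦ x)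
  · conv_rhs => enter [2]; rw [← hid]
    rw [← cfc_smul _ _ _ (hc _)]
    refine cfc_mono (fun x hx ↦ ?_) (hc _) (hc _)
    have h1 : ‖x⁻¹‖ ≤ ‖cfc (fun x : ℝ ↦ x⁻¹) w‖ :=
      norm_apply_le_norm_cfc (fun x : ℝ ↦ x⁻¹) w hx (hc _)
    have h2 : 0 ≤ x := spectrum_nonneg_of_nonneg hw hx
    rw [mul_comm, smul_eq_mul]
    exact mul_le_mul_of_nonneg_right ((le_abs_self _).trans h1) h2

/-- A nonzero positive element whose image under an irreducible positive map is dominated by a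
multiple of itself is invertible. -/
theorem isUnit_of_map_le_smul [FiniteDimensional ℂ A] {τ : A →L[ℂ] A}
    (hpos : ∀ x, 0 ≤ x → 0 ≤ τ x)
    (hirr : ¬∃ e : A, IsSelfAdjoint e ∧ e * e = e ∧ e ≠ 0 ∧ e ≠ 1 ∧
      ∀ x : A, e * τ (e * x * e) * e = τ (e * x * e))
    {w : A} (hw : 0 ≤ w) (hw0 : w ≠ 0) {d : ℝ} (hd : 0 ≤ d) (h : τ w ≤ d • w) : IsUnit w := by
  obtain ⟨e, w', he, hew, hwe, hww', hw'w, c, hc, hec⟩ := exists_support_projection hw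
  have hesa : star e = e := he.isSelfAdjoint
  have hee : e * e = e := he.isIdempotentElem
  have hmono {x y : A} (hxy : x ≤ y) : τ x ≤ τ y := by
    simpa using hpos (y - x) (sub_nonneg.2 hxy)
  have hsmul (s : ℝ) (x : A) : τ (s • x) = s • τ x := τ.map_smul_of_tower s x
  have conj_le (x : A) (hx : 0 ≤ x) : e * x * e ≤ ‖x‖ • e := by
    simpa [hesa, hee] using
      CStarAlgebra.star_left_conjugate_le_norm_smul (a := e) (b := x) (.of_nonneg hx)
  have hinv (x : A) (hx : 0 ≤ x) : e * τ (e * x * e) * e = τ (e * x * e) := by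
    have hp : 0 ≤ τ (e * x * e) := hpos _ (by
      simpa [hesa] using star_left_conjugate_nonneg hx e)
    have hle : τ (e * x * e) ≤ (‖x‖ * c * d * ‖w‖ + 1) • e := calc
      τ (e * x * e) ≤ τ (‖x‖ • c • w) :=
        hmono ((conj_le x hx).trans (smul_le_smul_of_nonneg_left hec (norm_nonneg x)))
      _ = ‖x‖ • c • τ w := by rw [hsmul, hsmul]
      _ ≤ ‖x‖ • c • d • ‖w‖ • e := by
        have : w ≤ ‖w‖ • e := by simpa [hew, hwe] using conj_le w hw
        gcongr
        exact h.trans (smul_le_smul_of_nonneg_left this hd)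
      _ = (‖x‖ * c * d * ‖w‖) • e := by simp only [smul_smul, mul_assoc]
      _ ≤ _ := smul_le_smul_of_nonneg_right (by linarith) he.nonneg
    have hD : 0 < ‖x‖ * c * d * ‖w‖ + 1 := by positivity
    set D := ‖x‖ * c * d * ‖w‖ + 1
    have h1 : D⁻¹ • τ (e * x * e) ≤ e := by
      have := smul_le_smul_of_nonneg_left hle (inv_nonneg.2 hD.le)
      rwa [smul_smul, inv_mul_cancel₀ hD.ne', one_smul] at this
    have h2 := he.conjugate_of_nonneg_of_le (smul_nonneg (inv_nonneg.2 hD.le) hp) h1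
    rw [mul_smul_comm, smul_mul_assoc] at h2
    exact smul_right_injective A (inv_ne_zero hD.ne') h2
  have hinv' (x : A) : e * τ (e * x * e) * e = τ (e * x * e) := by
    have hx : x ∈ Submodule.span ℂ {a : A | 0 ≤ a} := by simp [CStarAlgebra.span_nonneg]
    induction hx using Submodule.span_induction with
    | mem x hx => exact hinv x hx
    | zero => simp
    | add x y _ _ hx hy => simp only [mul_add, add_mul, map_add, hx, hy]
    | smul s x _ hx => simp only [mul_smul_comm, smul_mul_assoc, map_smul, hx]
  have he1 : e = 1 := by
    by_contra he1
    exact hirr ⟨e, he.isSelfAdjoint, hee, fun h0 ↦ hw0 (by rw [← hew, h0, zero_mul]), he1, hinv'⟩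
  exact ⟨⟨w, w', hww'.trans he1, hw'w.trans he1⟩, rfl⟩

/-- The resolvent of a positive map at a large scalar is positive. -/
theorem exists_positive_resolvent {τ : A →L[ℂ] A} (hpos : ∀ x, 0 ≤ x → 0 ≤ τ x) :
    ∃ (t : ℝ) (G : A →L[ℂ] A), 0 < t ∧ (∀ x, 0 ≤ x → 0 ≤ G x) ∧ (∀ x, G (τ x) = τ (G x)) ∧
      ∀ x, G x = x + t • τ (G x) := by
  set t : ℝ := (‖τ‖ + 1)⁻¹
  have ht : 0 < t := by positivity
  set S : A →L[ℂ] A := (t : ℂ) • τ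
  have hSapp (x : A) : S x = t • τ x := by simp [S]
  have hS : ‖S‖ < 1 := by
    rw [norm_smul, Complex.norm_real, Real.norm_of_nonneg ht.le, inv_mul_lt_one₀ (by positivity)]
    linarith
  have hsum := summable_geometric_of_norm_lt_one hS
  have hSpos (n : ℕ) (x : A) (hx : 0 ≤ x) : 0 ≤ (S ^ n) x := by
    induction n with
    | zero => simpa
    | succ n ih =>
      rw [pow_succ', mul_apply_eq_comp, hSapp]
      exact smul_nonneg ht.le (hpos _ ih)
  have happ (x : A) : HasSum (fun n ↦ (S ^ n) x) ((∑' n, S ^ n) x) :=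
    hsum.hasSum.mapL (ContinuousLinearMap.apply ℂ A x)
  refine ⟨t, ∑' n, S ^ n, ht, fun x hx ↦ ?_, fun x ↦ ?_, fun x ↦ ?_⟩
  · exact (happ x).nonneg fun n ↦ hSpos n x hx
  · have hcomm : Commute (∑' n, S ^ n) τ := by
      refine Commute.tsum_left _ fun n ↦ Commute.pow_left ?_ n
      exact ContinuousLinearMap.ext fun x ↦ by simp [hSapp, τ.map_smul_of_tower]
    exact congr($(hcomm.eq) x)
  · have := congr($(mul_neg_geom_series S hS) x)
    simp only [sub_mul, one_mul] at this
    rw [← hSapp]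
    exact sub_eq_iff_eq_add.1 this

/-- An irreducible positive map has a strictly positive eigenvector (Collatz-Wielandt argument). -/
theorem exists_pos_eigenvector [FiniteDimensional ℂ A] [Nontrivial A] {τ : A →L[ℂ] A}
    (hpos : ∀ x, 0 ≤ x → 0 ≤ τ x)
    (hirr : ¬∃ e : A, IsSelfAdjoint e ∧ e * e = e ∧ e ≠ 0 ∧ e ≠ 1 ∧
      ∀ x : A, e * τ (e * x * e) * e = τ (e * x * e)) :
    ∃ (l : ℝ) (L : A), 0 ≤ l ∧ 0 ≤ L ∧ IsUnit L ∧ τ L = l • L := by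
  have : ProperSpace A := FiniteDimensional.proper ℂ A
  have hsmul (s : ℝ) (x : A) : τ (s • x) = s • τ x := τ.map_smul_of_tower s x
  set K : Set (ℝ × A) := (Set.Icc 0 ‖τ‖ ×ˢ Metric.sphere 0 1) ∩
    {p | 0 ≤ p.2 ∧ p.1 • p.2 ≤ τ p.2}
  have hK : IsCompact K := by
    refine (isCompact_Icc.prod (isCompact_sphere _ _)).inter_right ?_
    exact (isClosed_le continuous_const continuous_snd).inter
      (isClosed_le (by fun_prop) (by fun_prop))
  have hKmem {l : ℝ} {y : A} (hl : 0 ≤ l) (hy : 0 ≤ y) (hy0 : y ≠ 0) (hly : l • y ≤ τ y) :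
      (l, ‖y‖⁻¹ • y) ∈ K := by
    have hn : 0 < ‖y‖ := norm_pos_iff.2 hy0
    refine ⟨⟨⟨hl, ?_⟩, ?_⟩, smul_nonneg (by positivity) hy, ?_⟩
    · have h1 := CStarAlgebra.norm_le_norm_of_nonneg_of_le (smul_nonneg hl hy) hly
      rw [norm_smul, Real.norm_of_nonneg hl] at h1
      exact le_of_mul_le_mul_right (h1.trans (τ.le_opNorm y)) hn
    · simp [norm_smul, hn.ne']
    · change l • ‖y‖⁻¹ • y ≤ τ (‖y‖⁻¹ • y)
      rw [hsmul, smul_comm]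
      gcongr
  have hne : K.Nonempty := ⟨_, hKmem le_rfl zero_le_one one_ne_zero (by
    simpa using hpos 1 zero_le_one)⟩
  obtain ⟨⟨l, x⟩, ⟨⟨⟨hl, -⟩, hx1⟩, hx, hlx⟩, hmax⟩ :=
    hK.exists_isMaxOn hne continuous_fst.continuousOn
  dsimp only at hl hx1 hx hlx
  have hx0 : x ≠ 0 := by rintro rfl; simp at hx1
  have heq : τ x = l • x := by
    by_contra hcon
    have hz : 0 ≤ τ x - l • x := sub_nonneg.2 hlx
    have hz0 : τ x - l • x ≠ 0 := sub_ne_zero.2 hcon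
    obtain ⟨t, G, ht, hG, hGτ, hGr⟩ := exists_positive_resolvent hpos
    have hle {u : A} (hu : 0 ≤ u) : u ≤ G u := by
      conv_rhs => rw [hGr]
      exact le_add_of_nonneg_right (smul_nonneg ht.le (hpos _ (hG u hu)))
    have hne0 {u : A} (hu : 0 ≤ u) (hu0 : u ≠ 0) : G u ≠ 0 := fun h0 ↦
      hu0 (le_antisymm (h0 ▸ hle hu) hu)
    set z := τ x - l • x with hzdef
    have hGz : IsUnit (G z) := by
      refine isUnit_of_map_le_smul hpos hirr (hG z hz) (hne0 hz hz0) (inv_nonneg.2 ht.le) ?_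
      have h1 : t • τ (G z) ≤ G z := by
        conv_rhs => rw [hGr]
        exact le_add_of_nonneg_left hz
      have := smul_le_smul_of_nonneg_left h1 (inv_nonneg.2 ht.le)
      rwa [smul_smul, inv_mul_cancel₀ ht.ne', one_smul] at this
    obtain ⟨ε, hε, hεz⟩ := (CFC.exists_pos_algebraMap_le_iff (.of_nonneg (hG z hz))).2
      fun s hs ↦ (spectrum_nonneg_of_nonneg (hG z hz) hs).lt_of_ne'
        (spectrum.ne_zero_of_mem_of_unit (a := hGz.unit) hs)
    have hy0 := hne0 hx hx0
    have hn : 0 < ‖G x‖ := norm_pos_iff.2 hy0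
    have hyle : (ε / ‖G x‖) • G x ≤ G z := by
      refine le_trans ?_ hεz
      have := IsSelfAdjoint.le_algebraMap_norm_self (a := G x) (.of_nonneg (hG x hx))
      have := smul_le_smul_of_nonneg_left this (show 0 ≤ ε / ‖G x‖ by positivity)
      refine this.trans_eq ?_
      rw [Algebra.algebraMap_eq_smul_one, Algebra.algebraMap_eq_smul_one, smul_smul,
        div_mul_cancel₀ _ hn.ne']
    have hGzeq : G z = τ (G x) - l • G x := by
      rw [hzdef, map_sub, hGτ, G.map_smul_of_tower]
    have hmem : (l + ε / ‖G x‖, ‖G x‖⁻¹ • G x) ∈ K := by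
      refine hKmem (by positivity) (hG x hx) hy0 ?_
      rw [add_smul, ← le_sub_iff_add_le', ← hGzeq]
      exact hyle
    have h1 : l + ε / ‖G x‖ ≤ l := hmax hmem
    have h2 : 0 < ε / ‖G x‖ := by positivity
    linarith
  exact ⟨l, x, hl, hx, isUnit_of_map_le_smul hpos hirr hx hx0 hl heq.le, heq⟩

theorem PreservesGram.map_nonneg {σ : A →L[ℂ] A} (h : PreservesGram σ) {x : A} (hx : 0 ≤ x) :
    0 ≤ σ x := by
  obtain ⟨b, rfl⟩ := CStarAlgebra.nonneg_iff_eq_star_mul_self.1 hx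
  obtain ⟨C, hC⟩ := h 1 !![b]
  have := congr($hC 0 0)
  simp [Matrix.mul_apply] at this
  rw [this]
  exact star_mul_self_nonneg _

theorem PreservesGram.norm_map_star_mul_sq_le {σ : A →L[ℂ] A} (h : PreservesGram σ) (a b : A) :
    ‖σ (star a * b)‖ ^ 2 ≤ ‖σ (star a * a)‖ * ‖σ (star b * b)‖ := by
  obtain ⟨C, hC⟩ := h 2 !![a, b; 0, 0]
  have h00 := congr($hC 0 0)
  have h01 := congr($hC 0 1)
  have h11 := congr($hC 1 1)
  simp [Matrix.mul_apply, Fin.sum_univ_two] at h00 h01 h11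
  let X (j : Fin 2) : WithCStarModule A (Fin 2 → A) :=
    (WithCStarModule.equiv A (Fin 2 → A)).symm fun k ↦ star (C k j)
  have hX (i j : Fin 2) : inner A (X i) (X j) = star (C 0 j) * C 0 i + star (C 1 j) * C 1 i := by
    simp [X, WithCStarModule.pi_inner, WithCStarModule.inner_def, Fin.sum_univ_two]
  have hcs := CStarModule.norm_inner_le (A := A) (WithCStarModule A (Fin 2 → A))
    (x := X 1) (y := X 0)
  have hn (i : Fin 2) := CStarModule.norm_sq_eq (A := A) (x := X i)
  calc ‖σ (star a * b)‖ ^ 2 ≤ (‖X 1‖ * ‖X 0‖) ^ 2 := by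
        rw [h01, ← hX]; gcongr
    _ = _ := by rw [mul_pow, hn, hn, hX, hX, h00, h11, mul_comm]

theorem PreservesGram.norm_eq [Nontrivial A] {σ : A →L[ℂ] A} (h : PreservesGram σ) {l : ℝ}
    (hl : 0 ≤ l) (h1 : σ 1 = l • 1) : ‖σ‖ = l := by
  have hn1 : ‖σ 1‖ = l := by rw [h1, norm_smul, norm_one, mul_one, Real.norm_of_nonneg hl]
  refine le_antisymm (σ.opNorm_le_bound hl fun x ↦ ?_) ?_
  · have hx := h.norm_map_star_mul_sq_le 1 x
    rw [star_one, one_mul, one_mul, hn1] at hx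
    have hle : σ (star x * x) ≤ ‖x‖ ^ 2 • σ 1 := by
      have h2 : star x * x ≤ ‖x‖ ^ 2 • (1 : A) := by
        rw [← Algebra.algebraMap_eq_smul_one]
        exact CStarAlgebra.star_mul_le_algebraMap_norm_sq
      have h3 := h.map_nonneg (sub_nonneg.2 h2)
      rw [map_sub, σ.map_smul_of_tower] at h3
      exact sub_nonneg.1 h3
    have h4 := CStarAlgebra.norm_le_norm_of_nonneg_of_le (h.map_nonneg (star_mul_self_nonneg x)) hle
    rw [norm_smul, hn1, Real.norm_of_nonneg (by positivity)] at h4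
    refine le_of_sq_le_sq ?_ (by positivity)
    calc _ ≤ _ := hx
      _ ≤ l * (‖x‖ ^ 2 * l) := by gcongr
      _ = _ := by ring
  · simpa [hn1] using σ.le_opNorm 1

end PositiveMaps

/-- Let `τ` be an irreducible completely positive map (complete positivity expressed via
Kraus-type factorizations `(B* B).map τ = C* C` of matrices over the algebra) on a finite
dimensional C*-algebra with spectral radius `r > 0`. Then there is a strictly positive
eigenvector `L` with `τ(L) = r L`, and consequently a map `σ = α_v⁻¹ ∘ τ ∘ α_v` elementarily
similar to `τ` with `‖σ‖ = r`. -/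
theorem stmt19 {A : Type*} [CStarAlgebra A] [PartialOrder A] [StarOrderedRing A]
    [FiniteDimensional ℂ A]
    (τ : A →L[ℂ] A)
    (hcp : ∀ (k : ℕ) (B : Matrix (Fin k) (Fin k) A),
      ∃ C : Matrix (Fin k) (Fin k) A, (Bᴴ * B).map τ = Cᴴ * C)
    (hirr : ¬∃ e : A, IsSelfAdjoint e ∧ e * e = e ∧ e ≠ 0 ∧ e ≠ 1 ∧
      ∀ x : A, e * τ (e * x * e) * e = τ (e * x * e))
    (r : ℝ) (hr0 : 0 < r) (hr : spectralRadius ℂ τ = ENNReal.ofReal r) :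
    (∃ L : A, 0 ≤ L ∧ IsUnit L ∧ τ L = (r : ℂ) • L) ∧
    ∃ v : Aˣ, 0 ≤ (v : A) ∧
      ‖(ContinuousLinearMap.mulLeftRight ℂ A (star ((↑v⁻¹ : A))) (↑v⁻¹ : A)).comp
        (τ.comp (ContinuousLinearMap.mulLeftRight ℂ A (star (v : A)) (v : A)))‖ = r := by
  have hcp' : PreservesGram τ := hcp
  have hpos (x : A) (hx : 0 ≤ x) : 0 ≤ τ x := hcp'.map_nonneg hx
  rcases subsingleton_or_nontrivial A with hA | hA
  · rw [spectrum.SpectralRadius.of_subsingleton] at hr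
    exact absurd (ENNReal.ofReal_eq_zero.1 hr.symm) (not_le.2 hr0)
  obtain ⟨l, L, hl, hL, hLu, hτL⟩ := exists_pos_eigenvector hpos hirr
  obtain ⟨v, hv⟩ := (CFC.isUnit_sqrt_iff L).2 hLu
  have hv0 : 0 ≤ (v : A) := hv ▸ CFC.sqrt_nonneg L
  have hvsa : star (v : A) = v := (IsSelfAdjoint.of_nonneg hv0)
  have hvv : (v : A) * v = L := by rw [hv, CFC.sqrt_mul_sqrt_self L]
  have hvi : star ((↑v⁻¹ : A)) = ↑v⁻¹ := by
    rw [← Units.coe_star, star_inv, (Units.ext hvsa : star v = v)]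
  set σ := (ContinuousLinearMap.mulLeftRight ℂ A (star ((↑v⁻¹ : A))) (↑v⁻¹ : A)).comp
    (τ.comp (ContinuousLinearMap.mulLeftRight ℂ A (star (v : A)) (v : A))) with hσ
  have hσ1 : σ 1 = l • 1 := by
    have hvLv : (↑v⁻¹ : A) * L * ↑v⁻¹ = 1 := by simp [← hvv]
    simp [hσ, hvsa, hvi, hvv, hτL, hvLv]
  have hnorm : ‖σ‖ = l := (hcp'.conj _ _).norm_eq hl hσ1
  let U : (A →L[ℂ] A)ˣ :=
    { val := ContinuousLinearMap.mulLeftRight ℂ A v v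
      inv := ContinuousLinearMap.mulLeftRight ℂ A (↑v⁻¹ : A) (↑v⁻¹ : A)
      val_inv := by ext x; simp [mul_assoc]
      inv_val := by ext x; simp [mul_assoc] }
  have hspec : spectrum ℂ σ = spectrum ℂ τ := by
    rw [← spectrum.units_conjugate' (a := τ) (u := U), hσ, hvsa, hvi]
    rfl
  have hle : spectralRadius ℂ τ ≤ ENNReal.ofReal l := by
    have h1 := spectrum.spectralRadius_le_nnnorm (𝕜 := ℂ) σ
    rw [spectralRadius, hspec] at h1
    rwa [← hnorm, ofReal_norm]
  have hge : ENNReal.ofReal l ≤ spectralRadius ℂ τ := by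
    have hmem : (l : ℂ) ∈ spectrum ℂ τ := by
      rw [spectrum.mem_iff]
      intro hu
      obtain ⟨u, hu⟩ := hu
      have h0 : (u : A →L[ℂ] A) L = 0 := by
        rw [hu]
        simp [hτL, Algebra.algebraMap_eq_smul_one]
      have h1 : L = 0 := by
        rw [← one_apply_eq_self (F := A →L[ℂ] A) L, ← u.inv_mul,
          mul_apply_eq_comp, h0, map_zero]
      exact hLu.ne_zero h1
    have h1 := le_iSup₂ (f := fun k (_ : k ∈ spectrum ℂ τ) ↦ (‖k‖₊ : ENNReal)) (l : ℂ) hmem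
    refine le_trans (le_of_eq ?_) h1
    rw [← enorm_eq_nnnorm, ← ofReal_norm, Complex.norm_real, Real.norm_of_nonneg hl]
  have hlr : l = r := by
    rw [← ENNReal.ofReal_eq_ofReal_iff hl hr0.le, ← hr]
    exact le_antisymm hge hle
  subst hlr
  exact ⟨⟨L, hL, hLu, by rw [hτL, Complex.coe_smul]⟩, v, hv0, hnorm⟩
end
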